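/- arXiv:2312.16434 — 3 statements merged into one kernel-verified Lean document; each statement's English description precedes it below -/
import Mathlib

section
/- Let d ≥ 1 be an integer, s ∈ (0,1/2), γ > 0, τ > d−1, and let α ∈ ℝ^d satisfy the Diophantine condition DC_d(γ,τ). Then there exists an infinite set K ⊆ ℤ^d such that, with v(θ) = Σ_{k∈K} e^{−|k|^s} cos⟨k,θ⟩, for every real λ with 0 < |λ| ≤ 1 and every θ ∈ ℝ^d, to each k ∈ K one can assign a bounded connected component I_k = (E_k⁻, E_k⁺) of ℝ ∖ spec(H_{λv,α,θ}) (a spectral gap) whose length satisfies |λ|² e^{−(13/6)|k|^{2s}} ≤ E_k⁺ − E_k⁻ ≤ |λ|^{1/2} e^{−(3/20)|k|^s}, and the assignment k ↦ I_k is injective on K. -/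
open scoped Real BigOperators

/-- `α ∈ ℝ^d` satisfies the Diophantine condition `DC_d(γ,τ)`. -/
def IsDiophantine (d : ℕ) (γ τ : ℝ) (α : Fin d → ℝ) : Prop :=
  ∀ n : Fin d → ℤ, n ≠ 0 → ∀ j : ℤ,
    |(∑ i, (n i : ℝ) * α i) - 2 * Real.pi * (j : ℝ)| > γ / ‖n‖ ^ τ

section Auxiliary

open scoped ComplexConjugate

section Hilbert

variable {F : Type*} [NormedAddCommGroup F] [InnerProductSpace ℝ F]

theorem norm_sq_le_of_symmetric_nonneg (B : F →L[ℝ] F)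
    (hB : ∀ x y, inner ℝ (B x) y = inner ℝ x (B y)) (hpos : ∀ x, 0 ≤ inner ℝ (B x) x)
    {M : ℝ} (hM : 0 < M) (hM' : ‖B‖ ≤ M) (x : F) : ‖B x‖ ^ 2 ≤ M * inner ℝ (B x) x := by
  have h1 := hpos (x - M⁻¹ • B x)
  have h2 : inner ℝ (B (B x)) (B x) ≤ M * ‖B x‖ ^ 2 := by
    calc inner ℝ (B (B x)) (B x) ≤ ‖B (B x)‖ * ‖B x‖ := real_inner_le_norm _ _
      _ ≤ (M * ‖B x‖) * ‖B x‖ := by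
        gcongr
        exact (B.le_opNorm _).trans (by gcongr)
      _ = _ := by ring
  have h3 : inner ℝ (B (B x)) x = ‖B x‖ ^ 2 := by
    rw [hB, real_inner_self_eq_norm_sq]
  have h4 : inner ℝ (B x) (B x) = ‖B x‖ ^ 2 := real_inner_self_eq_norm_sq _
  simp only [map_sub, map_smul, inner_sub_left, inner_sub_right, inner_smul_left,
    inner_smul_right, h3, h4, conj_trivial] at h1
  have h5 : M⁻¹ * (M⁻¹ * inner ℝ (B (B x)) (B x)) ≤ M⁻¹ * ‖B x‖ ^ 2 := by
    calc M⁻¹ * (M⁻¹ * inner ℝ (B (B x)) (B x)) ≤ M⁻¹ * (M⁻¹ * (M * ‖B x‖ ^ 2)) := by gcongr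
      _ = _ := by field_simp
  have h6 : M⁻¹ * ‖B x‖ ^ 2 ≤ inner ℝ (B x) x := by linarith
  calc ‖B x‖ ^ 2 = M * (M⁻¹ * ‖B x‖ ^ 2) := by field_simp
    _ ≤ _ := by gcongr

theorem exists_mem_spectrum_abs_le (T : F →L[ℝ] F)
    (hT : ∀ x y, inner ℝ (T x) y = inner ℝ x (T y)) {ρ : ℝ} (hρ : 0 ≤ ρ) {u : F} (hu : u ≠ 0)
    (h : ‖T u‖ ≤ ρ * ‖u‖) : ∃ e ∈ spectrum ℝ T, |e| ≤ ρ := by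
  let A : Set ℝ := {m | ∃ x : F, ‖x‖ = 1 ∧ m = ‖T x‖ ^ 2}
  have hnu : 0 < ‖u‖ := norm_pos_iff.2 hu
  have hbdd : BddBelow A := ⟨0, by rintro m ⟨x, -, rfl⟩; positivity⟩
  set μ := sInf A with hμ
  have hmem : ‖T (‖u‖⁻¹ • u)‖ ^ 2 ∈ A := ⟨_, by simp [norm_smul, hnu.ne'], rfl⟩
  have hμ0 : 0 ≤ μ := Real.sInf_nonneg (by rintro m ⟨x, -, rfl⟩; positivity)
  have hμρ : μ ≤ ρ ^ 2 := by
    refine (csInf_le hbdd hmem).trans ?_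
    have : ‖T (‖u‖⁻¹ • u)‖ ≤ ρ := by
      rw [map_smul, norm_smul, norm_inv, norm_norm]
      rw [inv_mul_le_iff₀ hnu]; linarith
    gcongr
  have hlow : ∀ x, μ * ‖x‖ ^ 2 ≤ ‖T x‖ ^ 2 := by
    intro x
    rcases eq_or_ne x 0 with rfl | hx
    · simp
    have hx' := norm_pos_iff.2 hx
    have : μ ≤ ‖T (‖x‖⁻¹ • x)‖ ^ 2 :=
      csInf_le hbdd ⟨_, by simp [norm_smul, hx'.ne'], rfl⟩
    rw [map_smul, norm_smul, norm_inv, norm_norm, mul_pow] at this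
    calc μ * ‖x‖ ^ 2 ≤ (‖x‖⁻¹ ^ 2 * ‖T x‖ ^ 2) * ‖x‖ ^ 2 := by gcongr
      _ = _ := by field_simp
  set B : F →L[ℝ] F := T * T - algebraMap ℝ _ μ with hB
  have hBx : ∀ x, B x = T (T x) - μ • x := fun x => by
    simp [hB, Algebra.algebraMap_eq_smul_one]
  have hBs : ∀ x y, inner ℝ (B x) y = inner ℝ x (B y) := fun x y => by
    simp only [hBx, inner_sub_left, inner_sub_right, hT, inner_smul_left, inner_smul_right,
      conj_trivial]
  have hBi : ∀ x, inner ℝ (B x) x = ‖T x‖ ^ 2 - μ * ‖x‖ ^ 2 := fun x => by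
    rw [hBx, inner_sub_left, hT, real_inner_self_eq_norm_sq, inner_smul_left,
      real_inner_self_eq_norm_sq]; simp
  have hnu : ¬ IsUnit B := by
    intro hunit
    obtain ⟨c, hc, hcx⟩ : ∃ c : ℝ, 0 < c ∧ ∀ x, c * ‖x‖ ≤ ‖B x‖ := by
      obtain ⟨v, hv⟩ := hunit
      refine ⟨(‖(v⁻¹ : (F →L[ℝ] F)ˣ).val‖ + 1)⁻¹, by positivity, fun x => ?_⟩
      rw [inv_mul_le_iff₀ (by positivity)]
      have h1 : (v⁻¹ : (F →L[ℝ] F)ˣ).val (B x) = x := by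
        rw [← hv, ← mul_apply_eq_comp, Units.inv_mul]; rfl
      calc ‖x‖ = ‖(v⁻¹ : (F →L[ℝ] F)ˣ).val (B x)‖ := by rw [h1]
        _ ≤ ‖(v⁻¹ : (F →L[ℝ] F)ˣ).val‖ * ‖B x‖ := ContinuousLinearMap.le_opNorm _ _
        _ ≤ _ := by gcongr; linarith
    have hM : 0 < ‖B‖ + 1 := by positivity
    have key : ∀ m ∈ A, μ + c ^ 2 / (‖B‖ + 1) ≤ m := by
      rintro m ⟨x, hx, rfl⟩
      have h1 := norm_sq_le_of_symmetric_nonneg B hBs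
        (fun x => by rw [hBi]; linarith [hlow x]) hM (by linarith) x
      have h2 := pow_le_pow_left₀ (by positivity) (hcx x) 2
      rw [hBi, hx] at h1
      rw [hx] at h2
      have : c ^ 2 / (‖B‖ + 1) ≤ ‖T x‖ ^ 2 - μ := by
        rw [div_le_iff₀ hM]; nlinarith
      linarith
    have h3 := le_csInf ⟨_, hmem⟩ key
    have : 0 < c ^ 2 / (‖B‖ + 1) := by positivity
    linarith
  have hfac : B = (T - algebraMap ℝ _ (Real.sqrt μ)) * (T + algebraMap ℝ _ (Real.sqrt μ)) := by
    have hcomm := Algebra.commutes (Real.sqrt μ) T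
    have hs : (algebraMap ℝ (F →L[ℝ] F) (Real.sqrt μ)) * algebraMap ℝ _ (Real.sqrt μ)
        = algebraMap ℝ _ μ := by rw [← map_mul, Real.mul_self_sqrt hμ0]
    rw [hB, sub_mul, mul_add, mul_add, hcomm, hs]; abel
  have hsq : |Real.sqrt μ| ≤ ρ := by
    rw [abs_of_nonneg (Real.sqrt_nonneg _)]
    exact Real.sqrt_le_iff.2 ⟨hρ, hμρ⟩
  by_cases h1 : IsUnit (T - algebraMap ℝ (F →L[ℝ] F) (Real.sqrt μ))
  · refine ⟨-Real.sqrt μ, ?_, by rwa [abs_neg]⟩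
    rw [spectrum.mem_iff]
    intro h2
    apply hnu
    rw [hfac]
    refine h1.mul ?_
    have := h2.neg
    rwa [neg_sub, map_neg, sub_neg_eq_add] at this
  · refine ⟨Real.sqrt μ, ?_, hsq⟩
    rw [spectrum.mem_iff]
    intro h2
    apply h1
    have := h2.neg
    rwa [neg_sub] at this

theorem exists_mem_spectrum_near (T : F →L[ℝ] F)
    (hT : ∀ x y, inner ℝ (T x) y = inner ℝ x (T y)) (e : ℝ) {ρ : ℝ} (hρ : 0 ≤ ρ) {u : F}
    (hu : u ≠ 0) (h : ‖T u - e • u‖ ≤ ρ * ‖u‖) : ∃ e' ∈ spectrum ℝ T, |e' - e| ≤ ρ := by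
  obtain ⟨e₁, he₁, hle⟩ := exists_mem_spectrum_abs_le (T - algebraMap ℝ _ e)
    (fun x y => by simp [Algebra.algebraMap_eq_smul_one, inner_sub_left, inner_sub_right, hT,
      inner_smul_left, inner_smul_right]) hρ hu
    (by simpa [Algebra.algebraMap_eq_smul_one] using h)
  refine ⟨e₁ + e, ?_, by simpa using hle⟩
  rw [spectrum.mem_iff] at he₁ ⊢
  convert he₁ using 2
  rw [map_add]; abel

variable [CompleteSpace F]

theorem isUnit_of_symmetric_of_bddBelow (T : F →L[ℝ] F)
    (hT : ∀ x y, inner ℝ (T x) y = inner ℝ x (T y)) {c : ℝ} (hc : 0 < c)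
    (h : ∀ x, c * ‖x‖ ≤ ‖T x‖) : IsUnit T := by
  have hu : IsUnit (T * T) := by
    refine ContinuousLinearMap.isUnit_of_forall_le_norm_inner_map (T * T)
      (c := (⟨c ^ 2, sq_nonneg c⟩ : NNReal)) (by exact_mod_cast pow_pos hc 2) fun x => ?_
    have h1 : inner ℝ ((T * T) x) x = ‖T x‖ ^ 2 := by
      rw [mul_apply_eq_comp, hT, real_inner_self_eq_norm_sq]
    rw [h1, Real.norm_of_nonneg (sq_nonneg _)]
    have := pow_le_pow_left₀ (by positivity) (h x) 2
    change ‖x‖ ^ 2 * c ^ 2 ≤ ‖T x‖ ^ 2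
    linarith [mul_pow c ‖x‖ 2]
  exact ((Commute.refl T).isUnit_mul_iff.1 hu).1

theorem notMem_spectrum_of_bddBelow (T : F →L[ℝ] F)
    (hT : ∀ x y, inner ℝ (T x) y = inner ℝ x (T y)) (e : ℝ) {c : ℝ} (hc : 0 < c)
    (h : ∀ x, c * ‖x‖ ≤ ‖T x - e • x‖) : e ∉ spectrum ℝ T := by
  rw [spectrum.notMem_iff, ← IsUnit.neg_iff, neg_sub]
  exact isUnit_of_symmetric_of_bddBelow _
    (fun x y => by simp [Algebra.algebraMap_eq_smul_one, inner_sub_left, inner_sub_right, hT,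
      inner_smul_left, inner_smul_right]) hc
    (by simpa [Algebra.algebraMap_eq_smul_one] using h)

end Hilbert

theorem exists_gap_of_isClosed {S : Set ℝ} (hS : IsClosed S) {E a b : ℝ}
    (hgap : ∀ x ∈ S, a ≤ |x - E|) (hl : ∃ x ∈ S, E - b ≤ x ∧ x ≤ E)
    (hr : ∃ x ∈ S, E ≤ x ∧ x ≤ E + b) :
    ∃ Em ∈ S, ∃ Ep ∈ S, Set.Ioo Em Ep ⊆ Sᶜ ∧ 2 * a ≤ Ep - Em ∧ Ep - Em ≤ 2 * b := by
  obtain ⟨x, hx, hx1, hx2⟩ := hl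
  obtain ⟨y, hy, hy1, hy2⟩ := hr
  have hb1 : BddAbove (S ∩ Set.Iic E) := ⟨E, fun z hz => hz.2⟩
  have hb2 : BddBelow (S ∩ Set.Ici E) := ⟨E, fun z hz => hz.2⟩
  have h1 := (hS.inter isClosed_Iic).csSup_mem ⟨x, hx, hx2⟩ hb1
  have h2 := (hS.inter isClosed_Ici).csInf_mem ⟨y, hy, hy1⟩ hb2
  have h3 := le_csSup hb1 (⟨hx, hx2⟩ : x ∈ S ∩ Set.Iic E)
  have h4 := csInf_le hb2 (⟨hy, hy1⟩ : y ∈ S ∩ Set.Ici E)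
  refine ⟨_, h1.1, _, h2.1, ?_, ?_, by linarith⟩
  · rintro z ⟨hz1, hz2⟩ hz
    rcases le_total z E with h | h
    · exact absurd (le_csSup hb1 (⟨hz, h⟩ : z ∈ S ∩ Set.Iic E)) (not_le.2 hz1)
    · exact absurd (csInf_le hb2 (⟨hz, h⟩ : z ∈ S ∩ Set.Ici E)) (not_le.2 hz2)
  · have h5 := hgap _ h1.1
    have h6 := hgap _ h2.1
    rw [abs_of_nonpos (by linarith [h1.2.out] : _ ≤ (0:ℝ))] at h5
    rw [abs_of_nonneg (by linarith [h2.2.out] : (0:ℝ) ≤ _)] at h6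
    linarith

theorem two_mul_im_mul_im (A ψ : ℂ) :
    2 * ((A * ψ).im * (A * conj ψ).im) = ‖A‖ ^ 2 * (ψ ^ 2).re - ‖ψ‖ ^ 2 * (A ^ 2).re := by
  rw [← Complex.normSq_eq_norm_sq, ← Complex.normSq_eq_norm_sq]
  simp only [Complex.normSq_apply, Complex.mul_im, Complex.conj_re, Complex.conj_im, pow_two,
    Complex.mul_re]
  ring

set_option maxHeartbeats 1000000 in
theorem lyapunov_step {A ψ c r G : ℂ} {u f s s0 β t ℓ b sg : ℝ} (hc : ‖c‖ = 1)
    (hψ2 : ‖ψ ^ 2 - c‖ ≤ 1 / 200) (hψn : |‖ψ‖ ^ 2 - 1| ≤ 1 / 200)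
    (hs0 : s0 ≠ 0) (hs : |s - s0| ≤ |s0| / 100) (hu : u * s = -(A * ψ).im)
    (hℓ : 0 < ℓ) (hβ : |β| = ℓ) (ht : |t| ≤ 6 / 100 * ℓ) (hr : ‖r‖ ≤ ℓ / 1000)
    (hb : b * |s0| = ℓ) (hsg : |sg| = 1) (hsgβ : sg * β = b * s0)
    (hG : G = ((β * c.re + t) * u : ℝ) * conj ψ + u * conj r - f * conj ψ) :
    |u| * |s0| ≤ 102 / 100 * ‖A‖ ∧ ‖G‖ ≤ 2 * b * ‖A‖ + 2 * |f| ∧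
    b * (c.re ^ 2 * ‖A‖ ^ 2 - c.re * (A ^ 2).re) - 1 / 5 * b * ‖A‖ ^ 2 - 22 / 10 * ‖A‖ * |f|
      - ‖G‖ ^ 2 ≤ sg * (-((A + G) ^ 2).im + (A ^ 2).im) := by
  have hs0' : 0 < |s0| := abs_pos.2 hs0
  have hb0 : 0 < b := by
    by_contra h; push Not at h; nlinarith
  have hψ1 : ‖ψ‖ ≤ 1003 / 1000 := by
    have := (abs_le.1 hψn).2
    nlinarith [norm_nonneg ψ]
  have hsl : 99 / 100 * |s0| ≤ |s| := by
    have := abs_sub_abs_le_abs_sub s0 s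
    rw [abs_sub_comm] at this; linarith
  have hspos : 0 < |s| := by nlinarith
  have hu1 : |u| * |s| ≤ 1003 / 1000 * ‖A‖ := by
    rw [← abs_mul, hu, abs_neg]
    calc |(A * ψ).im| ≤ ‖A * ψ‖ := Complex.abs_im_le_norm _
      _ = ‖A‖ * ‖ψ‖ := norm_mul _ _
      _ ≤ _ := by nlinarith [norm_nonneg A]
  have hu2 : |u| * |s0| ≤ 102 / 100 * ‖A‖ := by nlinarith [abs_nonneg u, norm_nonneg A]
  have hu3 : |u| * ℓ ≤ 102 / 100 * b * ‖A‖ := by rw [← hb]; nlinarith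
  have hcre : |c.re| ≤ 1 := by rw [← hc]; exact Complex.abs_re_le_norm c
  have hA := norm_nonneg A
  have hf := abs_nonneg f
  set R : ℂ := (t * u : ℝ) * conj ψ + u * conj r - f * conj ψ with hR
  have hGR : G = (β * c.re * u : ℝ) * conj ψ + R := by rw [hG, hR]; push_cast; ring
  have hRn : ‖R‖ ≤ 625 / 10000 * b * ‖A‖ + 101 / 100 * |f| := by
    calc ‖R‖ ≤ ‖((t * u : ℝ) : ℂ) * conj ψ‖ + ‖(u : ℂ) * conj r‖ + ‖(f : ℂ) * conj ψ‖ :=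
          (norm_sub_le _ _).trans (by gcongr; exact norm_add_le _ _)
      _ = |t| * |u| * ‖ψ‖ + |u| * ‖r‖ + |f| * ‖ψ‖ := by
          simp only [norm_mul, Complex.norm_real, RCLike.norm_conj, Real.norm_eq_abs]
      _ ≤ (6 / 100 * ℓ) * |u| * (1003 / 1000) + |u| * (ℓ / 1000) + |f| * (1003 / 1000) := by
          gcongr
      _ ≤ _ := by nlinarith [mul_nonneg hb0.le hA]
  have hmainn : ‖((β * c.re * u : ℝ) : ℂ) * conj ψ‖ ≤ 103 / 100 * b * ‖A‖ := by
    calc ‖((β * c.re * u : ℝ) : ℂ) * conj ψ‖ = |β| * |c.re| * |u| * ‖ψ‖ := by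
          simp only [norm_mul, Complex.norm_real, RCLike.norm_conj, Real.norm_eq_abs]
      _ ≤ ℓ * 1 * |u| * (1003 / 1000) := by rw [hβ]; gcongr
      _ ≤ _ := by nlinarith [mul_nonneg hb0.le hA]
  refine ⟨hu2, ?_, ?_⟩
  · rw [hGR]
    refine (norm_add_le _ _).trans ?_
    nlinarith [mul_nonneg hb0.le hA]
  set X := ‖A‖ ^ 2 * (ψ ^ 2).re - ‖ψ‖ ^ 2 * (A ^ 2).re with hX
  set X0 := ‖A‖ ^ 2 * c.re - (A ^ 2).re with hX0
  have hA2 : |(A ^ 2).re| ≤ ‖A‖ ^ 2 := by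
    rw [← norm_pow]; exact Complex.abs_re_le_norm _
  have hre : |(ψ ^ 2).re - c.re| ≤ 1 / 200 := by
    rw [← Complex.sub_re]; exact (Complex.abs_re_le_norm _).trans hψ2
  have hXX : |X - X0| ≤ 1 / 100 * ‖A‖ ^ 2 := by
    have : X - X0 = ‖A‖ ^ 2 * ((ψ ^ 2).re - c.re) - (‖ψ‖ ^ 2 - 1) * (A ^ 2).re := by
      rw [hX, hX0]; ring
    rw [this]
    calc _ ≤ |‖A‖ ^ 2 * ((ψ ^ 2).re - c.re)| + |(‖ψ‖ ^ 2 - 1) * (A ^ 2).re| := abs_sub _ _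
      _ = ‖A‖ ^ 2 * |(ψ ^ 2).re - c.re| + |‖ψ‖ ^ 2 - 1| * |(A ^ 2).re| := by
        rw [abs_mul, abs_mul, abs_of_nonneg (sq_nonneg ‖A‖)]
      _ ≤ ‖A‖ ^ 2 * (1 / 200) + 1 / 200 * ‖A‖ ^ 2 := by gcongr
      _ = _ := by ring
  have hX0n : |X0| ≤ 2 * ‖A‖ ^ 2 := by
    calc |X0| ≤ |‖A‖ ^ 2 * c.re| + |(A ^ 2).re| := abs_sub _ _
      _ = ‖A‖ ^ 2 * |c.re| + |(A ^ 2).re| := by rw [abs_mul, abs_of_nonneg (sq_nonneg ‖A‖)]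
      _ ≤ ‖A‖ ^ 2 * 1 + ‖A‖ ^ 2 := by gcongr
      _ = _ := by ring
  have hXn : |X| ≤ 201 / 100 * ‖A‖ ^ 2 := by
    have := abs_add_le (X - X0) X0
    rw [sub_add_cancel] at this; linarith
  have hs' : s ≠ 0 := abs_pos.1 hspos
  have hκ : |s0 / s - 1| ≤ 102 / 10000 := by
    rw [div_sub_one hs', abs_div, div_le_iff₀ hspos, abs_sub_comm]; nlinarith
  have hκX : |s0 / s * X - X0| ≤ 31 / 1000 * ‖A‖ ^ 2 := by
    have : s0 / s * X - X0 = (s0 / s - 1) * X + (X - X0) := by ring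
    rw [this]
    calc _ ≤ |s0 / s - 1| * |X| + |X - X0| := by rw [← abs_mul]; exact abs_add_le _ _
      _ ≤ 102 / 10000 * (201 / 100 * ‖A‖ ^ 2) + 1 / 100 * ‖A‖ ^ 2 := by gcongr
      _ ≤ _ := by nlinarith [sq_nonneg ‖A‖]
  have hcκ : |b * c.re * (s0 / s * X - X0)| ≤ b * (31 / 1000 * ‖A‖ ^ 2) := by
    rw [abs_mul, abs_mul, abs_of_pos hb0]
    calc b * |c.re| * |s0 / s * X - X0| ≤ b * 1 * (31 / 1000 * ‖A‖ ^ 2) := by gcongr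
      _ = _ := by ring
  have hu' : u = -(A * ψ).im / s := by field_simp; linarith
  have himr : (2 * A * ((β * c.re * u : ℝ) * conj ψ)).im
      = 2 * (β * c.re * u) * (A * conj ψ).im := by
    have : 2 * A * (((β * c.re * u : ℝ) : ℂ) * conj ψ)
      = ((2 * (β * c.re * u) : ℝ) : ℂ) * (A * conj ψ) := by push_cast; ring
    rw [this, Complex.im_ofReal_mul]
  have hmain : sg * -(2 * A * ((β * c.re * u : ℝ) * conj ψ)).im
      = b * c.re * (s0 / s * X) := by
    rw [himr, hX, ← two_mul_im_mul_im, hu']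
    calc _ = (sg * β) * c.re * (2 * ((A * ψ).im * (A * conj ψ).im)) / s := by ring
      _ = _ := by rw [hsgβ]; ring
  have hexp : sg * (-((A + G) ^ 2).im + (A ^ 2).im)
      = b * c.re * X0 + b * c.re * (s0 / s * X - X0) - sg * (2 * A * R + G ^ 2).im := by
    have : (A + G) ^ 2 = A ^ 2 + 2 * A * (((β * c.re * u : ℝ) : ℂ) * conj ψ)
        + (2 * A * R + G ^ 2) := by
      rw [show G ^ 2 = G * G by ring]; nth_rewrite 1 [hGR]; rw [hGR]; ring
    rw [this, Complex.add_im, Complex.add_im]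
    linear_combination hmain
  have hrem : |sg * (2 * A * R + G ^ 2).im| ≤ 2 * ‖A‖ * ‖R‖ + ‖G‖ ^ 2 := by
    rw [abs_mul, hsg, one_mul]
    refine (Complex.abs_im_le_norm _).trans ((norm_add_le _ _).trans ?_)
    simp [norm_pow]
  rw [hexp]
  have h1 := (abs_le.1 hcκ).1
  have h2 := (abs_le.1 hrem).2
  have h3 : 2 * ‖A‖ * ‖R‖ ≤ 2 * ‖A‖ * (625 / 10000 * b * ‖A‖ + 101 / 100 * |f|) := by gcongr
  have h4 : b * (c.re ^ 2 * ‖A‖ ^ 2 - c.re * (A ^ 2).re) = b * c.re * X0 := by rw [hX0]; ring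
  rw [h4]
  nlinarith [mul_nonneg hA hf, mul_nonneg hb0.le (sq_nonneg ‖A‖)]

theorem summable_int_shift {f : ℤ → ℝ} (hf : Summable f) (k : ℤ) :
    Summable fun n => f (n + k) := (Equiv.addRight k).summable_iff.2 hf

theorem tsum_int_shift (f : ℤ → ℝ) (k : ℤ) : ∑' n, f (n + k) = ∑' n, f n :=
  (Equiv.addRight k).tsum_eq f

theorem lyapunov_absorb {N F G b x g : ℝ} (hN : 0 ≤ N) (hG0 : 0 ≤ G) (hb : 0 < b)
    (hb1 : b ≤ 1 / 100) (hG : G ≤ 2 * b * N + 2 * F) (hg : g ≤ 15 / 1000)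
    (hx : b * (N ^ 2 / 2) - 1 / 5 * b * N ^ 2 - 22 / 10 * N * F - G ^ 2
      - g * (2 * N * G + G ^ 2) ≤ x) :
    1 / 20 * b * N ^ 2 - (9 + 13 / b) * F ^ 2 ≤ x := by
  have h1 : 2 * N * G ≤ 4 * b * N ^ 2 + 4 * (N * F) := by nlinarith
  have h2 : G ^ 2 ≤ 8 / 100 * (b * N ^ 2) + 8 * F ^ 2 := by
    have : G ^ 2 ≤ (2 * b * N + 2 * F) ^ 2 := by gcongr
    have h3 : b ^ 2 * N ^ 2 ≤ 1 / 100 * (b * N ^ 2) := by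
      have : 0 ≤ b * N ^ 2 := by positivity
      nlinarith
    nlinarith [sq_nonneg (b * N - F)]
  have h3 : g * (2 * N * G + G ^ 2) ≤ 15 / 1000 * (2 * N * G + G ^ 2) := by gcongr
  have h4 : 226 / 100 * (N * F) ≤ 1 / 10 * (b * N ^ 2) + 13 / b * F ^ 2 := by
    have h5 : 0 ≤ b * (N - 113 / 10 * (F / b)) ^ 2 := by positivity
    have h6 : b * (N - 113 / 10 * (F / b)) ^ 2
        = b * N ^ 2 - 226 / 10 * (N * F) + 12769 / 100 * (F ^ 2 / b) := by
      field_simp; ring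
    have h7 : 13 / b * F ^ 2 = 13 * (F ^ 2 / b) := by ring
    have h8 : 0 ≤ F ^ 2 / b := by positivity
    rw [h7]; linarith
  nlinarith [mul_nonneg hb.le (sq_nonneg N), sq_nonneg F]

set_option maxHeartbeats 1000000 in
theorem gap_bound (ψ c r : ℤ → ℂ) (V t : ℤ → ℝ) (χ : ℂ) {E β ℓ b c1 s0 : ℝ}
    (hc : ∀ n, ‖c n‖ = 1) (hcs : ∀ n, c (n + 1) = χ * c n)
    (hψ2 : ∀ n, ‖ψ n ^ 2 - c n‖ ≤ 1 / 200) (hψn : ∀ n, |‖ψ n‖ ^ 2 - 1| ≤ 1 / 200)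
    (hs0 : s0 ≠ 0) (hs : ∀ n, |(ψ n * conj (ψ (n - 1))).im - s0| ≤ |s0| / 100)
    (hψ : ∀ n, ψ (n + 1) + ψ (n - 1) + (V n - E : ℝ) * ψ n = r n)
    (hℓ : 0 < ℓ) (hβ : |β| = ℓ) (ht : ∀ n, |t n| ≤ 6 / 100 * ℓ) (hr : ∀ n, ‖r n‖ ≤ ℓ / 1000)
    (hb : b * |s0| = ℓ) (hb1 : b ≤ 1 / 100) (hc1 : 0 < c1) (hbc : b ≤ c1 / 100)
    (hχ1 : c1 ≤ ‖χ - 1‖) (hχ2 : c1 ≤ ‖χ ^ 2 - 1‖) :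
    ∃ K : ℝ, 0 < K ∧ ∀ u f : ℤ → ℝ, Summable (fun n => u n ^ 2) → Summable (fun n => f n ^ 2) →
      (∀ n, f n = u (n + 1) + u (n - 1) + (V n + β * (c n).re + t n - E) * u n) →
      ∑' n, u n ^ 2 ≤ K * ∑' n, f n ^ 2 := by
  have hs0' : 0 < |s0| := abs_pos.2 hs0
  have hb0 : 0 < b := by
    by_contra h; push Not at h; nlinarith
  obtain ⟨sg, hsg, hsgβ⟩ : ∃ sg : ℝ, |sg| = 1 ∧ sg * β = b * s0 := by
    have : |β| = |b * s0| := by rw [hβ, abs_mul, abs_of_pos hb0, hb]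
    rcases abs_eq_abs.1 this with h | h
    · exact ⟨1, by simp, by linarith⟩
    · exact ⟨-1, by simp, by linarith⟩
  refine ⟨(102 / 100 / |s0|) ^ 2 * (20 / b * (9 + 13 / b)), by positivity, ?_⟩
  intro u f hu hf hfu
  set A : ℤ → ℂ := fun n => u (n - 1) * conj (ψ n) - u n * conj (ψ (n - 1)) with hA
  set G : ℤ → ℂ := fun n => ((β * (c n).re + t n) * u n : ℝ) * conj (ψ n)
    + u n * conj (r n) - f n * conj (ψ n) with hG
  have hAs : ∀ n, A (n + 1) = A n + G n := by
    intro n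
    have h1 : conj (ψ (n + 1)) = conj (r n) - conj (ψ (n - 1)) - (V n - E : ℝ) * conj (ψ n) := by
      rw [← hψ n]; simp; ring
    simp only [hA, hG, add_sub_cancel_right, h1, hfu n]
    push_cast; ring
  have huA : ∀ n, u n * (ψ n * conj (ψ (n - 1))).im = -(A n * ψ n).im := by
    intro n
    have : A n * ψ n = (u (n - 1) * Complex.normSq (ψ n) : ℝ)
        - (u n : ℝ) * (ψ n * conj (ψ (n - 1))) := by
      rw [Complex.ofReal_mul, ← Complex.mul_conj]; simp only [hA]; ring
    rw [this, Complex.sub_im, Complex.ofReal_im, Complex.im_ofReal_mul]; ring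
  have hstep := fun n => lyapunov_step (A := A n) (G := G n) (f := f n) (hc n)
    (hψ2 n) (hψn n) hs0 (hs n)
    (huA n) hℓ hβ (ht n) (hr n) hb hsg hsgβ rfl
  set g1 : ℤ → ℝ := fun n => (c n / (χ - 1)).re with hg1
  set g2 : ℤ → ℝ := fun n => (c n ^ 2 / (χ ^ 2 - 1)).re with hg2
  have hχ1' : χ - 1 ≠ 0 := norm_pos_iff.1 (hc1.trans_le hχ1)
  have hχ2' : χ ^ 2 - 1 ≠ 0 := norm_pos_iff.1 (hc1.trans_le hχ2)
  have hg1s : ∀ n, g1 (n + 1) = g1 n + (c n).re := by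
    intro n
    simp only [hg1]; rw [← Complex.add_re, hcs]; congr 1; field_simp; ring
  have hg2s : ∀ n, g2 (n + 1) = g2 n + (2 * (c n).re ^ 2 - 1) := by
    intro n
    have h1 : (2 * (c n).re ^ 2 - 1) = (c n ^ 2).re := by
      have := hc n
      have h2 : (c n).re ^ 2 + (c n).im ^ 2 = 1 := by
        have := Complex.normSq_eq_norm_sq (c n)
        rw [hc n, Complex.normSq_apply] at this; linarith
      simp only [pow_two, Complex.mul_re]; nlinarith
    rw [h1]; simp only [hg2]; rw [← Complex.add_re, hcs]; congr 1; field_simp; ring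
  have hg1n : ∀ n, b * |g1 n| ≤ 1 / 100 := by
    intro n
    have : |g1 n| ≤ 1 / c1 := by
      refine (Complex.abs_re_le_norm _).trans ?_
      rw [norm_div, hc]; gcongr
    calc b * |g1 n| ≤ c1 / 100 * (1 / c1) := by gcongr
      _ = 1 / 100 := by field_simp
  have hg2n : ∀ n, b * |g2 n| ≤ 1 / 100 := by
    intro n
    have : |g2 n| ≤ 1 / c1 := by
      refine (Complex.abs_re_le_norm _).trans ?_
      rw [norm_div, norm_pow, hc, one_pow]; gcongr
    calc b * |g2 n| ≤ c1 / 100 * (1 / c1) := by gcongr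
      _ = 1 / 100 := by field_simp
  set Q : ℤ → ℝ := fun n => sg * (-(A n ^ 2).im)
    - b * (1 / 2 * g2 n * ‖A n‖ ^ 2 - g1 n * (A n ^ 2).re) with hQ
  have hQs : ∀ n, 1 / 20 * b * ‖A n‖ ^ 2 - (9 + 13 / b) * |f n| ^ 2 ≤ Q (n + 1) - Q n := by
    intro n
    obtain ⟨-, hGn, hP⟩ := hstep n
    refine lyapunov_absorb (norm_nonneg _) (norm_nonneg (G n)) hb0 hb1 hGn
      (g := b * (1 / 2 * |g2 (n + 1)| + |g1 (n + 1)|)) ?_ ?_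
    · linarith [hg1n (n + 1), hg2n (n + 1)]
    · have e1 : |‖A n + G n‖ ^ 2 - ‖A n‖ ^ 2| ≤ 2 * ‖A n‖ * ‖G n‖ + ‖G n‖ ^ 2 := by
        have h1 := norm_add_le (A n) (G n)
        have h2 : ‖A n‖ ≤ ‖A n + G n‖ + ‖G n‖ := by
          have := norm_sub_le (A n + G n) (G n); rwa [add_sub_cancel_right] at this
        have h3 := norm_nonneg (A n); have h4 := norm_nonneg (G n)
        have h5 := norm_nonneg (A n + G n)
        rw [abs_le]; constructor
        · by_cases h6 : ‖A n‖ ≤ ‖G n‖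
          · nlinarith
          · push Not at h6
            nlinarith [mul_self_le_mul_self (by linarith : 0 ≤ ‖A n‖ - ‖G n‖)
              (by linarith : ‖A n‖ - ‖G n‖ ≤ ‖A n + G n‖)]
        · nlinarith
      have e2 : |((A n + G n) ^ 2).re - (A n ^ 2).re| ≤ 2 * ‖A n‖ * ‖G n‖ + ‖G n‖ ^ 2 := by
        rw [← Complex.sub_re]
        refine (Complex.abs_re_le_norm _).trans ?_
        have : (A n + G n) ^ 2 - A n ^ 2 = 2 * A n * G n + G n ^ 2 := by ring
        rw [this]
        refine (norm_add_le _ _).trans ?_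
        simp
      set M := 2 * ‖A n‖ * ‖G n‖ + ‖G n‖ ^ 2 with hM
      have e3 : g2 (n + 1) * (‖A n + G n‖ ^ 2 - ‖A n‖ ^ 2) ≤ |g2 (n + 1)| * M :=
        (le_abs_self _).trans (by rw [abs_mul]; gcongr)
      have e4 : -(g1 (n + 1) * (((A n + G n) ^ 2).re - (A n ^ 2).re)) ≤ |g1 (n + 1)| * M :=
        (neg_le_abs _).trans (by rw [abs_mul]; gcongr)
      have e5 : Q (n + 1) - Q n = sg * (-((A n + G n) ^ 2).im + (A n ^ 2).im)
          - b * (1 / 2 * (2 * (c n).re ^ 2 - 1) * ‖A n‖ ^ 2 - (c n).re * (A n ^ 2).re)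
          - b * (1 / 2 * (g2 (n + 1) * (‖A n + G n‖ ^ 2 - ‖A n‖ ^ 2))
            + -(g1 (n + 1) * (((A n + G n) ^ 2).re - (A n ^ 2).re))) := by
        simp only [hQ, hAs]
        have h1 := hg1s n; have h2 := hg2s n
        have h1' : (c n).re = g1 (n + 1) - g1 n := by linarith
        have h2' : 2 * (c n).re ^ 2 - 1 = g2 (n + 1) - g2 n := by linarith
        rw [h2', h1']; ring
      rw [e5]
      have e6 : b * (1 / 2 * (g2 (n + 1) * (‖A n + G n‖ ^ 2 - ‖A n‖ ^ 2))
            + -(g1 (n + 1) * (((A n + G n) ^ 2).re - (A n ^ 2).re)))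
          ≤ b * (1 / 2 * (|g2 (n + 1)| * M) + |g1 (n + 1)| * M) := by gcongr
      linarith
  have hψ1 : ∀ n, ‖ψ n‖ ≤ 2 := fun n => by
    have := (abs_le.1 (hψn n)).2
    nlinarith [norm_nonneg (ψ n)]
  have hAsum : Summable fun n => ‖A n‖ ^ 2 := by
    have hu' : Summable fun n => u (n - 1) ^ 2 := summable_int_shift hu (-1)
    refine Summable.of_nonneg_of_le (fun n => by positivity) (fun n => ?_)
      ((hu.mul_left 8).add (hu'.mul_left 8))
    have h1 : ‖A n‖ ≤ 2 * |u (n - 1)| + 2 * |u n| := by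
      refine (norm_sub_le _ _).trans ?_
      rw [norm_mul, norm_mul, RCLike.norm_conj, RCLike.norm_conj, Complex.norm_real,
        Complex.norm_real, Real.norm_eq_abs, Real.norm_eq_abs]
      nlinarith [hψ1 n, hψ1 (n - 1), abs_nonneg (u n), abs_nonneg (u (n - 1))]
    have h2 := pow_le_pow_left₀ (norm_nonneg _) h1 2
    nlinarith [sq_nonneg (|u (n - 1)| - |u n|), sq_abs (u n), sq_abs (u (n - 1))]
  have hQsum : Summable Q := by
    refine Summable.of_norm_bounded (hAsum.mul_left 2) fun n => ?_
    have h1 : |(A n ^ 2).im| ≤ ‖A n‖ ^ 2 := by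
      rw [← norm_pow]; exact Complex.abs_im_le_norm _
    have h2 : |(A n ^ 2).re| ≤ ‖A n‖ ^ 2 := by
      rw [← norm_pow]; exact Complex.abs_re_le_norm _
    calc ‖Q n‖ ≤ |sg * (-(A n ^ 2).im)| + |b * (1 / 2 * g2 n * ‖A n‖ ^ 2 - g1 n * (A n ^ 2).re)| :=
          norm_sub_le _ _
      _ = |(A n ^ 2).im| + b * |1 / 2 * g2 n * ‖A n‖ ^ 2 - g1 n * (A n ^ 2).re| := by
          rw [abs_mul, hsg, abs_neg, one_mul, abs_mul, abs_of_pos hb0]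
      _ ≤ ‖A n‖ ^ 2 + b * (1 / 2 * |g2 n| * ‖A n‖ ^ 2 + |g1 n| * ‖A n‖ ^ 2) := by
          gcongr
          refine (abs_sub _ _).trans ?_
          rw [abs_mul, abs_mul, abs_mul, abs_of_nonneg (sq_nonneg ‖A n‖)]
          norm_num; gcongr
      _ ≤ _ := by nlinarith [hg1n n, hg2n n, sq_nonneg ‖A n‖]
  have hfa : Summable fun n => |f n| ^ 2 := by simpa using hf
  have htot : 1 / 20 * b * ∑' n, ‖A n‖ ^ 2 ≤ (9 + 13 / b) * ∑' n, f n ^ 2 := by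
    have h1 : ∑' n, (1 / 20 * b * ‖A n‖ ^ 2 - (9 + 13 / b) * |f n| ^ 2)
        ≤ ∑' n, (Q (n + 1) - Q n) :=
      ((hAsum.mul_left _).sub (hfa.mul_left _)).tsum_le_tsum hQs
        ((summable_int_shift hQsum 1).sub hQsum)
    rw [(hAsum.mul_left _).tsum_sub (hfa.mul_left _), (summable_int_shift hQsum 1).tsum_sub hQsum,
      tsum_int_shift, sub_self, tsum_mul_left, tsum_mul_left] at h1
    simp only [sq_abs] at h1
    linarith
  have huA2 : ∀ n, u n ^ 2 ≤ (102 / 100 / |s0|) ^ 2 * ‖A n‖ ^ 2 := by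
    intro n
    have h1 := (hstep n).1
    have h2 : |u n| ≤ 102 / 100 / |s0| * ‖A n‖ := by
      rw [div_mul_eq_mul_div, le_div_iff₀ hs0']; exact h1
    rw [← sq_abs (u n), ← mul_pow]; gcongr
  have h1 := hu.tsum_le_tsum huA2 (hAsum.mul_left _)
  rw [tsum_mul_left] at h1
  refine h1.trans ?_
  have h2 : ∑' n, ‖A n‖ ^ 2 ≤ 20 / b * ((9 + 13 / b) * ∑' n, f n ^ 2) := by
    rw [div_mul_eq_mul_div, le_div_iff₀ hb0]; linarith
  calc _ ≤ (102 / 100 / |s0|) ^ 2 * (20 / b * ((9 + 13 / b) * ∑' n, f n ^ 2)) := by gcongr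
    _ = _ := by ring

theorem l2_hasSum_sq (f : lp (fun _ : ℤ => ℝ) 2) : HasSum (fun n => f n ^ 2) (‖f‖ ^ 2) := by
  have := lp.hasSum_inner (𝕜 := ℝ) f f
  rw [real_inner_self_eq_norm_sq] at this
  simpa [pow_two] using this

theorem jacobi_symmetric (H : lp (fun _ : ℤ => ℝ) 2 →L[ℝ] lp (fun _ : ℤ => ℝ) 2) (V : ℤ → ℝ)
    (hH : ∀ u : lp (fun _ : ℤ => ℝ) 2, ∀ n : ℤ, H u n = u (n + 1) + u (n - 1) + V n * u n)
    (x y : lp (fun _ : ℤ => ℝ) 2) : inner ℝ (H x) y = inner ℝ x (H y) := by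
  have hsum : ∀ k : ℤ, Summable fun n => x (n + k) * y n := by
    intro k
    have h1 := summable_int_shift (l2_hasSum_sq x).summable k
    refine Summable.of_norm_bounded (h1.add (l2_hasSum_sq y).summable) fun n => ?_
    rw [Real.norm_eq_abs, abs_mul]
    nlinarith [sq_nonneg (|x (n + k)| - |y n|), sq_abs (x (n + k)), sq_abs (y n),
      sq_nonneg (x (n + k)), sq_nonneg (y n)]
  have hsum' : ∀ k : ℤ, Summable fun n => x n * y (n + k) := by
    intro k
    have := summable_int_shift (hsum (-k)) k
    simpa using this
  have heq : ∀ k : ℤ, ∑' n, x (n + k) * y n = ∑' n, x n * y (n + -k) := by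
    intro k
    rw [← tsum_int_shift _ (-k)]
    simp
  have h1 : inner ℝ (H x) y = ∑' n, (x (n + 1) * y n + x (n + -1) * y n + V n * x n * y n) := by
    rw [lp.inner_eq_tsum]
    refine tsum_congr fun n => ?_
    rw [hH]; simp [← sub_eq_add_neg]; ring
  have h2 : inner ℝ x (H y) = ∑' n, (x n * y (n + 1) + x n * y (n + -1) + V n * x n * y n) := by
    rw [lp.inner_eq_tsum]
    refine tsum_congr fun n => ?_
    rw [hH]; simp [← sub_eq_add_neg]; ring
  have hV : Summable fun n => V n * x n * y n := by
    have h3 := lp.summable_inner (𝕜 := ℝ) (H x) y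
    have h4 := h3.sub ((hsum 1).add (hsum (-1)))
    refine h4.congr fun n => ?_
    rw [hH]; simp [← sub_eq_add_neg]; ring
  rw [h1, h2, ((hsum 1).add (hsum (-1))).tsum_add hV, (hsum 1).tsum_add (hsum (-1)),
    ((hsum' 1).add (hsum' (-1))).tsum_add hV, (hsum' 1).tsum_add (hsum' (-1)), heq, heq]
  simp; ring

theorem exists_mem_spectrum_near_pair {F : Type*} [NormedAddCommGroup F] [InnerProductSpace ℝ F]
    (T : F →L[ℝ] F) (hT : ∀ x y, inner ℝ (T x) y = inner ℝ x (T y)) (e : ℝ) {ρ : ℝ}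
    (hρ : 0 ≤ ρ) {u v : F} (hu : u ≠ 0 ∨ v ≠ 0)
    (h : ‖T u - e • u‖ ^ 2 + ‖T v - e • v‖ ^ 2 ≤ ρ ^ 2 * (‖u‖ ^ 2 + ‖v‖ ^ 2)) :
    ∃ e' ∈ spectrum ℝ T, |e' - e| ≤ ρ := by
  have key : ∀ x : F, ‖T x - e • x‖ ^ 2 ≤ ρ ^ 2 * ‖x‖ ^ 2 → ‖T x - e • x‖ ≤ ρ * ‖x‖ := by
    intro x hx
    rw [← mul_pow] at hx
    exact le_of_sq_le_sq hx (by positivity)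
  by_cases h1 : u ≠ 0 ∧ ‖T u - e • u‖ ^ 2 ≤ ρ ^ 2 * ‖u‖ ^ 2
  · exact exists_mem_spectrum_near T hT e hρ h1.1 (key u h1.2)
  have h2 : v ≠ 0 := by
    by_contra hv
    subst hv
    apply h1
    refine ⟨by simpa using hu, by simpa using h⟩
  refine exists_mem_spectrum_near T hT e hρ h2 (key v ?_)
  by_cases hu0 : u = 0
  · subst hu0; simpa using h
  · have := not_le.1 (not_and.1 h1 hu0)
    nlinarith

theorem quasimode_bound (ψ c r : ℤ → ℂ) (V t : ℤ → ℝ) (W : ℤ → ℂ) (ζ η η' : ℂ)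
    {E β ℓ q ν ε : ℝ} (n : ℤ)
    (hc : ‖c n‖ = 1) (hψ1 : ∀ n, ‖ψ n‖ ≤ 101 / 100) (hψ0 : 99 / 100 ≤ ‖ψ n‖)
    (hψ : ψ (n + 1) + ψ (n - 1) + (V n - E : ℝ) * ψ n = r n)
    (hβ : |β| = ℓ) (ht : |t n| ≤ ℓ / 1000) (hr : ‖r n‖ ≤ ℓ / 1000)
    (h1 : ‖ψ (n + 1) - ζ * ψ n‖ ≤ ν) (h2 : ‖ψ (n - 1) - conj ζ * ψ n‖ ≤ ν)
    (hW1 : W (n + 1) = η * W n) (hW2 : W (n - 1) = η' * W n)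
    (hη : ‖η - 1 - q * Complex.I‖ ≤ ε) (hη' : ‖η' - 1 + q * Complex.I‖ ≤ ε)
    (hε : ε ≤ ℓ / 10) (hq : |q| * ν ≤ ℓ / 100) :
    ‖W (n + 1) * ψ (n + 1) + W (n - 1) * ψ (n - 1)
      + (V n + β * (c n).re + t n - (E - 2 * q * ζ.im) : ℝ) * (W n * ψ n)‖
      ≤ 2 * ℓ * ‖W n * ψ n‖ := by
  have hζ : ζ - conj ζ = 2 * ζ.im * Complex.I := by
    rw [Complex.sub_conj]; push_cast; ring
  have hℓ : 0 ≤ ℓ := hβ ▸ abs_nonneg β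
  have hexp : W (n + 1) * ψ (n + 1) + W (n - 1) * ψ (n - 1)
      + (V n + β * (c n).re + t n - (E - 2 * q * ζ.im) : ℝ) * (W n * ψ n)
      = W n * (r n + (β * (c n).re + t n : ℝ) * ψ n + ψ (n + 1) * (η - 1 - q * Complex.I)
        + ψ (n - 1) * (η' - 1 + q * Complex.I)
        + q * Complex.I * (ψ (n + 1) - ζ * ψ n) - q * Complex.I * (ψ (n - 1) - conj ζ * ψ n)) := by
    rw [hW1, hW2, ← hψ]; push_cast
    linear_combination (W n * ψ n * q * Complex.I) * hζ + (2 * W n * ψ n * q * ζ.im) * Complex.I_sq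
  rw [hexp, norm_mul, norm_mul]
  have hcre : |(c n).re| ≤ 1 := by rw [← hc]; exact Complex.abs_re_le_norm _
  have hpot : ‖((β * (c n).re + t n : ℝ) : ℂ)‖ ≤ ℓ + ℓ / 1000 := by
    rw [Complex.norm_real, Real.norm_eq_abs]
    refine (abs_add_le _ _).trans ?_
    rw [abs_mul, hβ]
    gcongr
    nlinarith
  have hI : ‖(q : ℂ) * Complex.I‖ = |q| := by simp
  have hε0 : 0 ≤ ε := (norm_nonneg _).trans hη
  have hmain : ‖r n + (β * (c n).re + t n : ℝ) * ψ n + ψ (n + 1) * (η - 1 - q * Complex.I)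
        + ψ (n - 1) * (η' - 1 + q * Complex.I)
        + q * Complex.I * (ψ (n + 1) - ζ * ψ n) - q * Complex.I * (ψ (n - 1) - conj ζ * ψ n)‖
      ≤ ℓ / 1000 + (ℓ + ℓ / 1000) * ‖ψ n‖ + 101 / 100 * ε + 101 / 100 * ε
        + |q| * ν + |q| * ν := by
    refine (norm_sub_le _ _).trans (add_le_add ((norm_add_le _ _).trans
      (add_le_add ((norm_add_le _ _).trans (add_le_add ((norm_add_le _ _).trans
      (add_le_add ((norm_add_le _ _).trans (add_le_add hr ?_)) ?_)) ?_)) ?_)) ?_)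
    · rw [norm_mul]; gcongr
    · rw [norm_mul]; gcongr; exact hψ1 _
    · rw [norm_mul]; gcongr; exact hψ1 _
    · rw [norm_mul, hI]; gcongr
    · rw [norm_mul, hI]; gcongr
  calc _ ≤ ‖W n‖ * (2 * ℓ * ‖ψ n‖) := by
        gcongr
        refine hmain.trans ?_
        nlinarith
    _ = _ := by ring

theorem exists_envelope (q : ℝ) {κ : ℝ} (hκ : 0 < κ) (hκ1 : κ ≤ 1) (hq : |q| ≤ 1) :
    ∃ W : ℤ → ℂ, (Summable fun n => ‖W n‖ ^ 2) ∧ (∀ n, W n ≠ 0) ∧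
      ∀ n, ∃ η η' : ℂ, W (n + 1) = η * W n ∧ W (n - 1) = η' * W n ∧
        ‖η - 1 - q * Complex.I‖ ≤ q ^ 2 + 2 * κ ∧ ‖η' - 1 + q * Complex.I‖ ≤ q ^ 2 + 2 * κ := by
  have hexp : ∀ (q x : ℝ), |q| ≤ 1 → |x| ≤ κ →
      ‖Complex.exp (q * Complex.I) * Real.exp x - 1 - q * Complex.I‖ ≤ q ^ 2 + 2 * κ := by
    intro q x hq hx
    have h1 : ‖Complex.exp (q * Complex.I) - 1 - q * Complex.I‖ ≤ q ^ 2 := by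
      have := Complex.norm_exp_sub_one_sub_id_le (x := q * Complex.I) (by simpa using hq)
      simpa using this
    have h2 : ‖Complex.exp (q * Complex.I) * (Real.exp x - 1 : ℝ)‖ ≤ 2 * κ := by
      rw [norm_mul, Complex.norm_exp_ofReal_mul_I, one_mul, Complex.norm_real, Real.norm_eq_abs]
      exact (Real.abs_exp_sub_one_le (hx.trans hκ1)).trans (by gcongr)
    have : Complex.exp (q * Complex.I) * Real.exp x - 1 - q * Complex.I
      = (Complex.exp (q * Complex.I) - 1 - q * Complex.I)
        + Complex.exp (q * Complex.I) * (Real.exp x - 1 : ℝ) := by push_cast; ring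
    rw [this]
    exact (norm_add_le _ _).trans (add_le_add h1 h2)
  refine ⟨fun n => Complex.exp ((q * n : ℝ) * Complex.I) * Real.exp (-κ * |(n : ℝ)|), ?_, ?_, ?_⟩
  · have h1 : ∀ n : ℤ, ‖Complex.exp ((q * n : ℝ) * Complex.I) * Real.exp (-κ * |(n : ℝ)|)‖ ^ 2
        = Real.exp (-(2 * κ)) ^ n.natAbs := by
      intro n
      rw [norm_mul, Complex.norm_exp_ofReal_mul_I, one_mul, Complex.norm_real, Real.norm_eq_abs,
        Real.abs_exp, ← Real.exp_nat_mul, ← Real.exp_nat_mul, Nat.cast_natAbs]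
      push_cast; ring_nf
    simp_rw [h1]
    have hg := summable_geometric_of_lt_one (Real.exp_nonneg (-(2 * κ)))
      (Real.exp_lt_one_iff.2 (by linarith))
    exact Summable.of_nat_of_neg (by simpa using hg) (by simpa using hg)
  · intro n
    exact mul_ne_zero (Complex.exp_ne_zero _) (by exact_mod_cast (Real.exp_pos _).ne')
  · intro n
    refine ⟨Complex.exp (q * Complex.I) * Real.exp (-κ * (|((n + 1 : ℤ) : ℝ)| - |(n : ℝ)|)),
      Complex.exp ((-q : ℝ) * Complex.I) * Real.exp (-κ * (|((n - 1 : ℤ) : ℝ)| - |(n : ℝ)|)),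
      ?_, ?_, ?_, ?_⟩
    · simp only [Complex.ofReal_exp, ← Complex.exp_add]
      congr 1; push_cast; ring
    · simp only [Complex.ofReal_exp, ← Complex.exp_add]
      congr 1; push_cast; ring
    · refine hexp q _ hq ?_
      rw [abs_mul, abs_neg, abs_of_pos hκ]
      have := abs_abs_sub_abs_le (((n + 1 : ℤ) : ℝ)) (n : ℝ)
      push_cast at this ⊢
      rw [add_sub_cancel_left, abs_one] at this
      nlinarith
    · have h1 := hexp (-q) (-κ * (|((n - 1 : ℤ) : ℝ)| - |(n : ℝ)|)) (by rwa [abs_neg]) ?_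
      · rw [neg_sq] at h1
        convert h1 using 2
        push_cast; ring
      rw [abs_mul, abs_neg, abs_of_pos hκ]
      have := abs_abs_sub_abs_le (((n - 1 : ℤ) : ℝ)) (n : ℝ)
      push_cast at this ⊢
      rw [sub_sub_cancel_left, abs_neg, abs_one] at this
      nlinarith

theorem exists_mem_spectrum_of_quasimode
    (H : lp (fun _ : ℤ => ℝ) 2 →L[ℝ] lp (fun _ : ℤ => ℝ) 2) (V : ℤ → ℝ)
    (hH : ∀ u : lp (fun _ : ℤ => ℝ) 2, ∀ n : ℤ, H u n = u (n + 1) + u (n - 1) + V n * u n)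
    (G : ℤ → ℂ) (hG : Summable fun n => ‖G n‖ ^ 2) (hG0 : G 0 ≠ 0) {e ρ : ℝ} (hρ : 0 ≤ ρ)
    (h : ∀ n, ‖G (n + 1) + G (n - 1) + (V n - e : ℝ) * G n‖ ≤ ρ * ‖G n‖) :
    ∃ e' ∈ spectrum ℝ H, |e' - e| ≤ ρ := by
  have hsq : ∀ z : ℂ, ‖z‖ ^ 2 = z.re ^ 2 + z.im ^ 2 := fun z => by
    rw [← Complex.normSq_eq_norm_sq, Complex.normSq_apply]; ring
  have hre : Summable fun n => (G n).re ^ 2 := hG.of_nonneg_of_le (fun n => sq_nonneg _)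
    fun n => by rw [hsq]; nlinarith [sq_nonneg (G n).im]
  have him : Summable fun n => (G n).im ^ 2 := hG.of_nonneg_of_le (fun n => sq_nonneg _)
    fun n => by rw [hsq]; nlinarith [sq_nonneg (G n).re]
  have hmem : ∀ f : ℤ → ℝ, (Summable fun n => f n ^ 2) → Memℓp f 2 := fun f hf =>
    memℓp_gen (by simpa using hf)
  let u : lp (fun _ : ℤ => ℝ) 2 := ⟨fun n => (G n).re, hmem _ hre⟩
  let v : lp (fun _ : ℤ => ℝ) 2 := ⟨fun n => (G n).im, hmem _ him⟩
  have hu : ∀ n, u n = (G n).re := fun _ => rfl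
  have hv : ∀ n, v n = (G n).im := fun _ => rfl
  refine exists_mem_spectrum_near_pair H (jacobi_symmetric H V hH) e hρ (u := u) (v := v) ?_ ?_
  · by_contra! hcon
    apply hG0
    apply Complex.ext
    · rw [← hu, hcon.1]; rfl
    · rw [← hv, hcon.2]; rfl
  · have h1 := l2_hasSum_sq (H u - e • u)
    have h2 := l2_hasSum_sq (H v - e • v)
    have h3 := (h1.add h2)
    have h4 := ((l2_hasSum_sq u).add (l2_hasSum_sq v)).mul_left (ρ ^ 2)
    refine hasSum_le (fun n => ?_) h3 h4
    have e1 : (H u - e • u) n = (G (n + 1) + G (n - 1) + (V n - e : ℝ) * G n).re := by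
      have : (H u - e • u) n = H u n - e * u n := rfl
      rw [this, hH, hu, hu, hu, Complex.add_re, Complex.add_re, Complex.re_ofReal_mul]; ring
    have e2 : (H v - e • v) n = (G (n + 1) + G (n - 1) + (V n - e : ℝ) * G n).im := by
      have : (H v - e • v) n = H v n - e * v n := rfl
      rw [this, hH, hv, hv, hv, Complex.add_im, Complex.add_im, Complex.im_ofReal_mul]; ring
    rw [e1, e2, hu, hv, ← hsq, ← hsq, ← mul_pow]
    have := h n
    gcongr

set_option maxHeartbeats 1000000 in
theorem exists_gap_of_approx_solution
    (H : lp (fun _ : ℤ => ℝ) 2 →L[ℝ] lp (fun _ : ℤ => ℝ) 2)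
    (g c U r : ℤ → ℂ) (V t : ℤ → ℝ) (ζ : ℂ) {E β ℓ b c1 ν : ℝ}
    (hH : ∀ u : lp (fun _ : ℤ => ℝ) 2, ∀ n : ℤ,
      H u n = u (n + 1) + u (n - 1) + (V n + β * (c n).re + t n) * u n)
    (hg : ∀ n, ‖g n‖ = 1) (hgs : ∀ n, g (n + 1) = ζ * g n) (hgc : ∀ n, g n ^ 2 = c n)
    (hζ : ‖ζ‖ = 1) (hζ0 : ζ.im ≠ 0) (hU : ∀ n, ‖U n - 1‖ ≤ ν) (hν : ν ≤ |ζ.im| / 2000)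
    (hψ : ∀ n, g (n + 1) * U (n + 1) + g (n - 1) * U (n - 1)
      + (V n - E : ℝ) * (g n * U n) = r n)
    (hℓ : 0 < ℓ) (hβ : |β| = ℓ) (ht : ∀ n, |t n| ≤ ℓ / 1000) (hr : ∀ n, ‖r n‖ ≤ ℓ / 1000)
    (hb : b * |ζ.im| = ℓ) (hb1 : b ≤ |ζ.im| / 100) (hc1 : 0 < c1) (hbc : b ≤ c1 / 100)
    (hχ1 : c1 ≤ ‖ζ ^ 2 - 1‖) (hχ2 : c1 ≤ ‖(ζ ^ 2) ^ 2 - 1‖) :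
    ∃ Em ∈ spectrum ℝ H, ∃ Ep ∈ spectrum ℝ H, Set.Ioo Em Ep ⊆ (spectrum ℝ H)ᶜ ∧
      ℓ / 10 ≤ Ep - Em ∧ Ep - Em ≤ 12 * ℓ := by
  have hζ0' : 0 < |ζ.im| := abs_pos.2 hζ0
  have hb0 : 0 < b := by
    by_contra h; push Not at h; nlinarith
  have hζ1 : |ζ.im| ≤ 1 := by rw [← hζ]; exact Complex.abs_im_le_norm _
  have hν0 : 0 ≤ ν := (norm_nonneg _).trans (hU 0)
  have hζζ : conj ζ * ζ = 1 := by
    rw [mul_comm, Complex.mul_conj, Complex.normSq_eq_norm_sq, hζ]; simp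
  have hgg : ∀ n, g n * conj (g n) = 1 := fun n => by
    rw [Complex.mul_conj, Complex.normSq_eq_norm_sq, hg]; simp
  have hgp : ∀ n, g n = ζ * g (n - 1) := fun n => by
    have := hgs (n - 1); rwa [sub_add_cancel] at this
  have hgm : ∀ n, g (n - 1) = conj ζ * g n := fun n => by
    rw [hgp n, ← mul_assoc, hζζ, one_mul]
  have hUn : ∀ n, |‖U n‖ - 1| ≤ ν := fun n => by
    have := abs_norm_sub_norm_le (U n) 1
    rw [norm_one] at this; exact this.trans (hU n)
  set ψ : ℤ → ℂ := fun n => g n * U n with hψd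
  have hψnU : ∀ n, ‖ψ n‖ = ‖U n‖ := fun n => by rw [hψd, norm_mul, hg, one_mul]
  have hψ1 : ∀ n, ‖ψ n‖ ≤ 101 / 100 := fun n => by
    rw [hψnU]; have := (abs_le.1 (hUn n)).2; linarith
  have hψ0 : ∀ n, 99 / 100 ≤ ‖ψ n‖ := fun n => by
    rw [hψnU]; have := (abs_le.1 (hUn n)).1; linarith
  have hprod : ∀ a a' : ℂ, ‖a - 1‖ ≤ ν → ‖a' - 1‖ ≤ ν → ‖a * a' - 1‖ ≤ 3 * ν := by
    intro a a' h1 h2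
    have : a * a' - 1 = (a - 1) * (a' - 1) + (a - 1) + (a' - 1) := by ring
    rw [this]
    have h3 : ‖(a - 1) * (a' - 1)‖ ≤ ν * 1 := by
      rw [norm_mul]; gcongr; linarith
    have := norm_add₃_le (a := (a - 1) * (a' - 1)) (b := a - 1) (c := a' - 1)
    linarith
  have hψ2 : ∀ n, ‖ψ n ^ 2 - c n‖ ≤ 1 / 200 := fun n => by
    have : ψ n ^ 2 - c n = g n ^ 2 * (U n * U n - 1) := by rw [← hgc, hψd]; ring
    rw [this, norm_mul, norm_pow, hg, one_pow, one_mul]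
    exact (hprod _ _ (hU n) (hU n)).trans (by linarith)
  have hψn : ∀ n, |‖ψ n‖ ^ 2 - 1| ≤ 1 / 200 := fun n => by
    have h1 := (abs_le.1 (hUn n))
    rw [hψnU, abs_le]; constructor <;> nlinarith
  have hconj : ∀ n, ‖conj (U n) - 1‖ ≤ ν := fun n => by
    rw [← RCLike.norm_conj]; simpa using hU n
  have hs : ∀ n, |(ψ n * conj (ψ (n - 1))).im - ζ.im| ≤ |ζ.im| / 100 := fun n => by
    rw [← Complex.sub_im]
    refine (Complex.abs_im_le_norm _).trans ?_
    have : ψ n * conj (ψ (n - 1)) - ζ = ζ * (U n * conj (U (n - 1)) - 1) := by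
      simp only [hψd]; rw [hgp n, map_mul]
      linear_combination (ζ * U n * conj (U (n - 1))) * hgg (n - 1)
    rw [this, norm_mul, hζ, one_mul]
    exact (hprod _ _ (hU n) (hconj _)).trans (by linarith)
  have hc : ∀ n, ‖c n‖ = 1 := fun n => by rw [← hgc, norm_pow, hg, one_pow]
  have hcs : ∀ n, c (n + 1) = ζ ^ 2 * c n := fun n => by rw [← hgc, ← hgc, hgs, mul_pow]
  have hclosed : IsClosed (spectrum ℝ H) := spectrum.isClosed H
  have hspec : ∀ q : ℝ, |q| = 2 * b → ∃ e' ∈ spectrum ℝ H,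
      |e' - (E - 2 * q * ζ.im)| ≤ 2 * ℓ := by
    intro q hq
    have hℓ1 : ℓ ≤ 1 / 100 := by nlinarith
    obtain ⟨W, hWs, hW0, hW⟩ := exists_envelope q (κ := ℓ / 50) (by linarith) (by linarith)
      (by rw [hq]; linarith)
    refine exists_mem_spectrum_of_quasimode H _ hH (fun n => W n * ψ n) ?_ ?_ (by linarith) ?_
    · refine Summable.of_nonneg_of_le (fun n => by positivity) (fun n => ?_) (hWs.mul_left 2)
      rw [norm_mul, mul_pow]
      have h1 : ‖ψ n‖ ^ 2 ≤ 2 := by nlinarith [hψ1 n, norm_nonneg (ψ n)]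
      nlinarith [sq_nonneg ‖W n‖]
    · refine mul_ne_zero (hW0 0) (norm_pos_iff.1 ?_)
      linarith [hψ0 0]
    · intro n
      obtain ⟨η, η', hη1, hη2, hη3, hη4⟩ := hW n
      refine quasimode_bound ψ c r V t W ζ η η' (ν := 2 * ν) n (hc n) hψ1 (hψ0 n) (hψ n) hβ (ht n)
        (hr n) ?_ ?_ hη1 hη2 hη3 hη4 ?_ ?_
      · have : ψ (n + 1) - ζ * ψ n = ζ * g n * ((U (n + 1) - 1) - (U n - 1)) := by
          simp only [hψd]; rw [hgs]; ring
        rw [this, norm_mul, norm_mul, hζ, hg, one_mul, one_mul]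
        exact (norm_sub_le _ _).trans (by linarith [hU n, hU (n + 1)])
      · have : ψ (n - 1) - conj ζ * ψ n = conj ζ * g n * ((U (n - 1) - 1) - (U n - 1)) := by
          simp only [hψd]; rw [hgm]; ring
        rw [this, norm_mul, norm_mul, RCLike.norm_conj, hζ, hg, one_mul, one_mul]
        exact (norm_sub_le _ _).trans (by linarith [hU n, hU (n - 1)])
      · have : q ^ 2 = 4 * b ^ 2 := by rw [← sq_abs, hq]; ring
        rw [this]
        nlinarith
      · rw [hq]; nlinarith
  have hside : (∃ x ∈ spectrum ℝ H, E - 6 * ℓ ≤ x ∧ x ≤ E) ∧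
      (∃ x ∈ spectrum ℝ H, E ≤ x ∧ x ≤ E + 6 * ℓ) := by
    obtain ⟨x, hx, hx'⟩ := hspec (2 * b) (abs_of_pos (by linarith))
    obtain ⟨y, hy, hy'⟩ := hspec (-(2 * b)) (by rw [abs_neg]; exact abs_of_pos (by linarith))
    rw [abs_le] at hx' hy'
    rcases abs_cases ζ.im with ⟨h1, -⟩ | ⟨h1, -⟩
    · rw [h1] at hb
      exact ⟨⟨x, hx, by nlinarith, by nlinarith⟩, ⟨y, hy, by nlinarith, by nlinarith⟩⟩
    · rw [h1] at hb
      exact ⟨⟨y, hy, by nlinarith, by nlinarith⟩, ⟨x, hx, by nlinarith, by nlinarith⟩⟩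
  have hgap : ∀ x ∈ spectrum ℝ H, ℓ / 20 ≤ |x - E| := by
    intro e he
    by_contra! hlt
    obtain ⟨K, hK, hKu⟩ := gap_bound ψ c r V (fun n => t n - (e - E)) (ζ ^ 2) hc hcs hψ2 hψn hζ0 hs
      hψ hℓ hβ (fun n => (abs_sub _ _).trans (by linarith [ht n])) hr hb (by linarith) hc1 hbc
      hχ1 hχ2
    refine notMem_spectrum_of_bddBelow H (jacobi_symmetric H _ hH) e
      (c := (Real.sqrt K)⁻¹) (by positivity) (fun u => ?_) he
    have h1 := hKu u (fun n => (H u - e • u) n) (l2_hasSum_sq u).summable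
      (l2_hasSum_sq _).summable (fun n => by
        have : (H u - e • u) n = H u n - e * u n := rfl
        rw [this, hH]; ring)
    rw [(l2_hasSum_sq u).tsum_eq, (l2_hasSum_sq _).tsum_eq] at h1
    rw [inv_mul_le_iff₀ (by positivity)]
    refine le_of_sq_le_sq ?_ (by positivity)
    rwa [mul_pow, Real.sq_sqrt hK.le]
  obtain ⟨Em, h1, Ep, h2, h3, h4, h5⟩ := exists_gap_of_isClosed hclosed hgap hside.1 hside.2
  exact ⟨Em, h1, Ep, h2, h3, by linarith, by linarith⟩

/-- Trigonometric polynomials in one variable, as Laurent polynomials in `e^{iθ}`. -/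
abbrev TrigPoly := AddMonoidAlgebra ℂ ℤ

namespace TrigPoly

open AddMonoidAlgebra

/-- The character `m ↦ e^{imx}` of `ℤ`. -/
noncomputable def chr (x : ℝ) : Multiplicative ℤ →* ℂ where
  toFun m := Complex.exp ((x * (m.toAdd : ℝ) : ℝ) * Complex.I)
  map_one' := by simp
  map_mul' a b := by
    rw [← Complex.exp_add]; congr 1; push_cast [toAdd_mul]; ring

/-- Translation by `x`. -/
noncomputable def shift (x : ℝ) : TrigPoly →ₐ[ℂ] TrigPoly :=
  AddMonoidAlgebra.lift ℂ TrigPoly ℤ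
    { toFun := fun m => single m.toAdd (chr x m)
      map_one' := by rw [(chr x).map_one]; rfl
      map_mul' := fun a b => by rw [single_mul_single, ← map_mul]; rfl }

/-- Evaluation at the point `x`. -/
noncomputable def ev (x : ℝ) : TrigPoly →ₐ[ℂ] ℂ := AddMonoidAlgebra.lift ℂ ℂ ℤ (chr x)

/-- Complex conjugation of trigonometric polynomials. -/
noncomputable def cj : TrigPoly →+* TrigPoly :=
  (mapDomainRingHom ℂ (-AddMonoidHom.id ℤ)).comp (mapRingHom ℤ (starRingEnd ℂ))

/-- The Fourier multiplier with symbol `d`. -/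
noncomputable def mult (d : ℤ → ℂ) (f : TrigPoly) : TrigPoly :=
  ofCoeff (Finsupp.onFinset f.coeff.support (fun m => d m * f.coeff m)
    (fun m hm => by simpa using right_ne_zero_of_mul hm))

/-- The Wiener norm. -/
noncomputable def wn (f : TrigPoly) : ℝ := f.coeff.sum fun _ a => ‖a‖

/-- `f` has degree at most `D`. -/
def DegLE (D : ℕ) (f : TrigPoly) : Prop := ∀ m : ℤ, f.coeff m ≠ 0 → m.natAbs ≤ D

theorem shift_single (x : ℝ) (m : ℤ) (a : ℂ) :
    shift x (single m a) = single m (a * Complex.exp ((x * m : ℝ) * Complex.I)) := by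
  rw [shift, AddMonoidAlgebra.lift_single]
  exact smul_single _ _ _

theorem ev_single (x : ℝ) (m : ℤ) (a : ℂ) :
    ev x (single m a) = a * Complex.exp ((x * m : ℝ) * Complex.I) := by
  rw [ev, AddMonoidAlgebra.lift_single]; rfl

theorem cj_single (m : ℤ) (a : ℂ) : cj (single m a) = single (-m) (conj a) := by
  rw [cj, RingHom.comp_apply, mapRingHom_single]
  exact mapDomain_single

theorem coeff_mult (d : ℤ → ℂ) (f : TrigPoly) (m : ℤ) :
    (mult d f).coeff m = d m * f.coeff m := rfl

theorem coeff_shift (x : ℝ) (f : TrigPoly) (m : ℤ) :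
    (shift x f).coeff m = f.coeff m * Complex.exp ((x * m : ℝ) * Complex.I) := by
  induction f using AddMonoidAlgebra.induction_linear with
  | zero => simp
  | add f g hf hg => simp only [map_add, coeff_add, Finsupp.add_apply, hf, hg, add_mul]
  | single n a =>
    rw [shift_single, coeff_single, coeff_single, Finsupp.single_apply, Finsupp.single_apply]
    split_ifs with h
    · rw [h]
    · simp

theorem coeff_cj (f : TrigPoly) (m : ℤ) : (cj f).coeff m = conj (f.coeff (-m)) := by
  induction f using AddMonoidAlgebra.induction_linear with
  | zero => simp
  | add f g hf hg => simp only [map_add, coeff_add, Finsupp.add_apply, hf, hg]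
  | single n a =>
    rw [cj_single, coeff_single, coeff_single, Finsupp.single_apply, Finsupp.single_apply]
    simp only [neg_eq_iff_eq_neg]
    split_ifs with h <;> simp

theorem coeff_algebraMap_mul (c : ℂ) (f : TrigPoly) (m : ℤ) :
    (algebraMap ℂ TrigPoly c * f).coeff m = c * f.coeff m := by
  rw [← Algebra.smul_def, coeff_smul_apply, smul_eq_mul]

theorem cj_cj (f : TrigPoly) : cj (cj f) = f := by
  ext m; simp [coeff_cj]

theorem cj_algebraMap (c : ℂ) : cj (algebraMap ℂ TrigPoly c) = algebraMap ℂ TrigPoly (conj c) := by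
  rw [coe_algebraMap]
  exact (cj_single _ _).trans (by rw [neg_zero]; rfl)

theorem cj_shift (x : ℝ) (f : TrigPoly) : cj (shift x f) = shift x (cj f) := by
  ext m
  simp only [coeff_cj, coeff_shift, map_mul, ← Complex.exp_conj]
  congr 2; simp

theorem shift_neg_shift (x : ℝ) (f : TrigPoly) : shift (-x) (shift x f) = f := by
  ext m
  rw [coeff_shift, coeff_shift, mul_assoc, ← Complex.exp_add]
  simp

theorem ev_shift (x y : ℝ) (f : TrigPoly) : ev x (shift y f) = ev (x + y) f := by
  induction f using AddMonoidAlgebra.induction_linear with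
  | zero => simp
  | add f g hf hg => simp only [map_add, hf, hg]
  | single n a =>
    rw [shift_single, ev_single, ev_single, mul_assoc, ← Complex.exp_add]
    congr 2; push_cast; ring

theorem wn_eq_sum (f : TrigPoly) {s : Finset ℤ} (hs : f.coeff.support ⊆ s) :
    wn f = ∑ m ∈ s, ‖f.coeff m‖ := Finsupp.sum_of_support_subset _ hs _ (by simp)

theorem wn_nonneg (f : TrigPoly) : 0 ≤ wn f := Finset.sum_nonneg fun _ _ => norm_nonneg _

theorem wn_le_of_coeff_le {f g : TrigPoly} {B : ℝ} (hB : 0 ≤ B)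
    (h : ∀ m, g.coeff m ≠ 0 → ‖g.coeff m‖ ≤ B * ‖f.coeff m‖) : wn g ≤ B * wn f := by
  rw [wn_eq_sum g (Finset.subset_union_left (s₂ := f.coeff.support)),
    wn_eq_sum f (Finset.subset_union_right (s₁ := g.coeff.support)), Finset.mul_sum]
  refine Finset.sum_le_sum fun m _ => ?_
  by_cases hm : g.coeff m = 0
  · rw [hm, norm_zero]; positivity
  · exact h m hm

theorem wn_zero : wn 0 = 0 := by simp [wn]

theorem wn_add (f g : TrigPoly) : wn (f + g) ≤ wn f + wn g := by
  classical
  set s := (f.coeff.support ∪ g.coeff.support) ∪ (f + g).coeff.support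
  rw [wn_eq_sum (f + g) (s := s) Finset.subset_union_right,
    wn_eq_sum f (s := s) (Finset.subset_union_left.trans Finset.subset_union_left),
    wn_eq_sum g (s := s) (Finset.subset_union_right.trans Finset.subset_union_left),
    ← Finset.sum_add_distrib]
  exact Finset.sum_le_sum fun m _ => by
    rw [coeff_add, Finsupp.add_apply]; exact norm_add_le _ _

theorem wn_neg (f : TrigPoly) : wn (-f) = wn f := by
  refine le_antisymm ?_ ?_
  · simpa using wn_le_of_coeff_le (f := f) (g := -f) zero_le_one (by simp)
  · simpa using wn_le_of_coeff_le (f := -f) (g := f) zero_le_one (by simp)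

theorem wn_sub (f g : TrigPoly) : wn (f - g) ≤ wn f + wn g := by
  rw [sub_eq_add_neg, ← wn_neg g]; exact wn_add _ _

theorem wn_single (m : ℤ) (a : ℂ) : wn (single m a) = ‖a‖ := by
  rw [wn, coeff_single]; exact Finsupp.sum_single_index norm_zero

theorem wn_sum_le {ι : Type*} (s : Finset ι) (f : ι → TrigPoly) :
    wn (∑ i ∈ s, f i) ≤ ∑ i ∈ s, wn (f i) := by
  classical
  induction s using Finset.induction_on with
  | empty => simp [wn_zero]
  | insert i s hi ih =>
    rw [Finset.sum_insert hi, Finset.sum_insert hi]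
    exact (wn_add _ _).trans (by gcongr)

theorem wn_mul (f g : TrigPoly) : wn (f * g) ≤ wn f * wn g := by
  rw [AddMonoidAlgebra.mul_def]
  refine (wn_sum_le _ _).trans ?_
  rw [wn, Finsupp.sum, Finset.sum_mul]
  refine Finset.sum_le_sum fun m _ => (wn_sum_le _ _).trans ?_
  rw [wn, Finsupp.sum, Finset.mul_sum]
  refine Finset.sum_le_sum fun n _ => ?_
  rw [wn_single, norm_mul]

theorem wn_mul_le {f g : TrigPoly} {a b : ℝ} (hf : wn f ≤ a) (hg : wn g ≤ b) :
    wn (f * g) ≤ a * b :=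
  (wn_mul f g).trans (mul_le_mul hf hg (wn_nonneg _) ((wn_nonneg _).trans hf))

theorem wn_algebraMap (c : ℂ) : wn (algebraMap ℂ TrigPoly c) = ‖c‖ := by
  rw [coe_algebraMap]; exact wn_single _ _

theorem wn_shift (x : ℝ) (f : TrigPoly) : wn (shift x f) = wn f := by
  have h : ∀ (x : ℝ) (f : TrigPoly), wn (shift x f) ≤ wn f := fun x f => by
    simpa using wn_le_of_coeff_le (f := f) (g := shift x f) zero_le_one (fun m _ => by
      rw [coeff_shift, norm_mul, Complex.norm_exp_ofReal_mul_I]; linarith)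
  refine le_antisymm (h x f) ?_
  simpa [shift_neg_shift] using h (-x) (shift x f)

theorem wn_cj (f : TrigPoly) : wn (cj f) = wn f := by
  classical
  rw [wn_eq_sum (cj f) (s := f.coeff.support.image Neg.neg), wn_eq_sum f subset_rfl,
    Finset.sum_image neg_injective.injOn]
  · simp [coeff_cj]
  · intro m hm
    rw [Finsupp.mem_support_iff, coeff_cj] at hm
    refine Finset.mem_image.2 ⟨-m, Finsupp.mem_support_iff.2 fun h => hm ?_, neg_neg m⟩
    rw [h, map_zero]

theorem norm_coeff_le_wn (f : TrigPoly) (m : ℤ) : ‖f.coeff m‖ ≤ wn f := by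
  by_cases h : m ∈ f.coeff.support
  · exact Finset.single_le_sum (f := fun m => ‖f.coeff m‖) (fun _ _ => norm_nonneg _) h
  · rw [Finsupp.notMem_support_iff.1 h, norm_zero]; exact wn_nonneg f

theorem norm_ev_le (x : ℝ) (f : TrigPoly) : ‖ev x f‖ ≤ wn f := by
  rw [ev, AddMonoidAlgebra.lift_apply]
  refine (norm_sum_le _ _).trans (Finset.sum_le_sum fun m _ => ?_)
  rw [norm_smul]
  simp only [chr, MonoidHom.coe_mk, OneHom.coe_mk, Complex.norm_exp_ofReal_mul_I, mul_one]
  rfl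

theorem wn_mult_le {d : ℤ → ℂ} {f : TrigPoly} {D : ℕ} {B : ℝ} (hB : 0 ≤ B) (hf : DegLE D f)
    (h : ∀ m : ℤ, m.natAbs ≤ D → ‖d m‖ ≤ B) : wn (mult d f) ≤ B * wn f := by
  refine wn_le_of_coeff_le hB fun m hm => ?_
  rw [coeff_mult] at hm ⊢
  rw [norm_mul]
  gcongr
  exact h m (hf m (right_ne_zero_of_mul hm))

theorem DegLE.mono {D D' : ℕ} {f : TrigPoly} (h : DegLE D f) (hD : D ≤ D') : DegLE D' f :=
  fun m hm => (h m hm).trans hD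

theorem DegLE.add {D : ℕ} {f g : TrigPoly} (hf : DegLE D f) (hg : DegLE D g) :
    DegLE D (f + g) := fun m hm => by
  by_cases h : f.coeff m = 0
  · refine hg m fun h' => hm ?_
    rw [coeff_add, Finsupp.add_apply, h, h', add_zero]
  · exact hf m h

theorem DegLE.neg {D : ℕ} {f : TrigPoly} (hf : DegLE D f) : DegLE D (-f) := fun m hm =>
  hf m (by simpa using hm)

theorem DegLE.sub {D : ℕ} {f g : TrigPoly} (hf : DegLE D f) (hg : DegLE D g) :
    DegLE D (f - g) := by rw [sub_eq_add_neg]; exact hf.add hg.neg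

theorem DegLE.single {D : ℕ} {m : ℤ} (hm : m.natAbs ≤ D) (a : ℂ) :
    DegLE D (AddMonoidAlgebra.single m a) := fun n hn => by
  rw [coeff_single, Finsupp.single_apply] at hn
  split_ifs at hn with h
  · rwa [← h]
  · exact absurd rfl hn

theorem DegLE.mul {D D' : ℕ} {f g : TrigPoly} (hf : DegLE D f) (hg : DegLE D' g) :
    DegLE (D + D') (f * g) := fun m hm => by
  classical
  have h1 := support_coeff_mul_subset f g (Finsupp.mem_support_iff.2 hm)
  obtain ⟨a, ha, b, hb, rfl⟩ := Finset.mem_add.1 h1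
  have := hf a (Finsupp.mem_support_iff.1 ha)
  have := hg b (Finsupp.mem_support_iff.1 hb)
  exact (Int.natAbs_add_le a b).trans (by omega)

theorem DegLE.algebraMap_mul {D : ℕ} {f : TrigPoly} (hf : DegLE D f) (c : ℂ) :
    DegLE D (algebraMap ℂ TrigPoly c * f) := fun m hm => by
  rw [coeff_algebraMap_mul] at hm; exact hf m (right_ne_zero_of_mul hm)

theorem DegLE.mult {D : ℕ} {f : TrigPoly} (hf : DegLE D f) (d : ℤ → ℂ) :
    DegLE D (mult d f) := fun m hm => by
  rw [coeff_mult] at hm; exact hf m (right_ne_zero_of_mul hm)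

theorem DegLE.shift {D : ℕ} {f : TrigPoly} (hf : DegLE D f) (x : ℝ) :
    DegLE D (shift x f) := fun m hm => by
  rw [coeff_shift] at hm; exact hf m (left_ne_zero_of_mul hm)

theorem DegLE.cj {D : ℕ} {f : TrigPoly} (hf : DegLE D f) : DegLE D (cj f) := fun m hm => by
  rw [coeff_cj] at hm
  simpa using hf (-m) fun h => hm (by rw [h, map_zero])

theorem degLE_algebraMap (D : ℕ) (c : ℂ) : DegLE D (algebraMap ℂ TrigPoly c) := by
  rw [coe_algebraMap]; exact DegLE.single (by simp) _

/-- The defect of `e^{ipn}u(x_n)` as a solution of the eigenvalue equation, where `z = e^{ip}`. -/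
noncomputable def defect (α : ℝ) (z : ℂ) (V u : TrigPoly) (E : ℝ) : TrigPoly :=
  algebraMap ℂ TrigPoly z * shift α u + algebraMap ℂ TrigPoly (conj z) * shift (-α) u +
    (V - algebraMap ℂ TrigPoly E) * u

theorem shift_algebraMap (x : ℝ) (c : ℂ) :
    shift x (algebraMap ℂ TrigPoly c) = algebraMap ℂ TrigPoly c := (shift x).commutes c

theorem coeff_algebraMap_zero (c : ℂ) : (algebraMap ℂ TrigPoly c).coeff 0 = c := by
  have := coeff_algebraMap_mul c 1 0
  rwa [mul_one, one_def, coeff_single, Finsupp.single_eq_same, mul_one] at this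

theorem coeff_algebraMap_of_ne {m : ℤ} (hm : m ≠ 0) (c : ℂ) :
    (algebraMap ℂ TrigPoly c).coeff m = 0 := by
  rw [← mul_one (algebraMap ℂ TrigPoly c), coeff_algebraMap_mul, one_def, coeff_single,
    Finsupp.single_eq_of_ne hm, mul_zero]

theorem cj_defect (α : ℝ) (z : ℂ) (V u : TrigPoly) (E : ℝ) (hV : cj V = V) :
    cj (defect α z V u E) = algebraMap ℂ TrigPoly (conj z) * shift α (cj u) +
      algebraMap ℂ TrigPoly z * shift (-α) (cj u) + (V - algebraMap ℂ TrigPoly E) * cj u := by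
  simp only [defect, map_add, map_mul, map_sub, cj_algebraMap, cj_shift, hV, Complex.conj_conj,
    Complex.conj_ofReal]

/-- The Wronskian of `e^{ipn}u(x_n)` and its complex conjugate. -/
noncomputable def wronskian (α : ℝ) (z : ℂ) (u : TrigPoly) : TrigPoly :=
  algebraMap ℂ TrigPoly (conj z) * (u * shift α (cj u)) -
    algebraMap ℂ TrigPoly z * (shift α u * cj u)

theorem wronskian_sub_shift (α : ℝ) (z : ℂ) (V u : TrigPoly) (E : ℝ) (hV : cj V = V) :
    wronskian α z u - shift (-α) (wronskian α z u) =
      u * cj (defect α z V u E) - cj u * defect α z V u E := by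
  rw [cj_defect _ _ _ _ _ hV, defect, wronskian]
  simp only [map_sub, map_mul, shift_algebraMap, shift_neg_shift]
  ring

theorem defect_add (α : ℝ) (z : ℂ) (V u y : TrigPoly) (E E' : ℝ) :
    defect α z V (u + y) (E + E') = defect α z V u E + defect α z V y E -
      algebraMap ℂ TrigPoly E' * (u + y) := by
  simp only [defect, map_add, Complex.ofReal_add]; ring

/-- The defect after a Newton correction `y = a u + b ū` solving the cohomological equations. -/
theorem defect_newton {α : ℝ} {z w : ℂ} {V u a b : TrigPoly} {E E' : ℝ} (hV : cj V = V)
    (hz : ‖z‖ = 1) {f : TrigPoly} (hf : f = algebraMap ℂ TrigPoly E' * u - defect α z V u E)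
    (ha : shift α a = a - algebraMap ℂ TrigPoly w * (f * cj u))
    (hb : algebraMap ℂ TrigPoly (z ^ 2) * shift α b = b + algebraMap ℂ TrigPoly w * (f * u)) :
    defect α z V (u + (a * u + b * cj u)) (E + E') =
      f * (algebraMap ℂ TrigPoly w * wronskian α z u - 1) + a * defect α z V u E +
        b * cj (defect α z V u E) - algebraMap ℂ TrigPoly E' * (a * u + b * cj u) := by
  have hzz : algebraMap ℂ TrigPoly (conj z) * algebraMap ℂ TrigPoly z = 1 := by
    rw [← map_mul, Complex.conj_mul', hz]; simp
  have ha' := congrArg (shift (-α)) ha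
  have hb' := congrArg (shift (-α)) hb
  simp only [map_sub, map_add, map_mul, shift_neg_shift, shift_algebraMap, map_pow] at ha' hb' hb
  rw [defect_add, cj_defect _ _ _ _ _ hV]
  have hf' : defect α z V u E = algebraMap ℂ TrigPoly E' * u - f := by rw [hf]; ring
  rw [show defect α z V (a * u + b * cj u) E =
    algebraMap ℂ TrigPoly z * (shift α a * shift α u + shift α b * shift α (cj u)) +
    algebraMap ℂ TrigPoly (conj z) * (shift (-α) a * shift (-α) u +
      shift (-α) b * shift (-α) (cj u)) + (V - algebraMap ℂ TrigPoly E) * (a * u + b * cj u) by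
    simp only [defect, map_add, map_mul]]
  have hd : defect α z V u E = algebraMap ℂ TrigPoly z * shift α u +
    algebraMap ℂ TrigPoly (conj z) * shift (-α) u + (V - algebraMap ℂ TrigPoly E) * u := rfl
  rw [wronskian]
  generalize shift (-α) a = S'a at *
  generalize shift (-α) b = S'b at *
  generalize shift (-α) u = S'u at *
  generalize shift (-α) f = S'f at *
  generalize shift (-α) (cj u) = S'ub at *
  generalize shift α (cj u) = Sub at *
  generalize shift α u = Su at *
  generalize shift α a = Sa at *
  generalize shift α b = Sb at *
  generalize cj u = ub at *
  generalize algebraMap ℂ TrigPoly z = Z at *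
  generalize algebraMap ℂ TrigPoly (conj z) = Zb at *
  generalize algebraMap ℂ TrigPoly w = W at *
  subst ha
  have e1 : S'a = a + W * (S'f * S'ub) := by linear_combination -ha'
  have e2 : Z * Sb = Zb * (b + W * (f * u)) := by linear_combination Zb * hb - Z * Sb * hzz
  have e3 : Zb * S'b = Z * b - Zb * (W * (S'f * S'u)) := by
    linear_combination -Zb * hb' + Z * b * hzz
  rw [e1]
  linear_combination hf' - a * hd + Sub * e2 + S'ub * e3

/-- The phase `e^{imα}`. -/
noncomputable def phase (α : ℝ) (m : ℤ) : ℂ := Complex.exp ((α * m : ℝ) * Complex.I)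

theorem coeff_shift' (α : ℝ) (f : TrigPoly) (m : ℤ) :
    (shift α f).coeff m = f.coeff m * phase α m := coeff_shift α f m

theorem phase_neg_left (α : ℝ) (m : ℤ) : phase (-α) m = phase α (-m) := by
  simp [phase]

theorem phase_zero (α : ℝ) : phase α 0 = 1 := by simp [phase]

theorem norm_phase (α : ℝ) (m : ℤ) : ‖phase α m‖ = 1 := Complex.norm_exp_ofReal_mul_I _

/-- Solution of `Sa = a - p` when `p` has mean zero. -/
theorem exists_shift_eq_sub {α κ : ℝ} {D : ℕ} (hκ : 0 ≤ κ)
    (h : ∀ m : ℤ, m ≠ 0 → m.natAbs ≤ D → 1 ≤ κ * ‖phase α m - 1‖)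
    {p : TrigPoly} (hp : DegLE D p) (hp0 : p.coeff 0 = 0) :
    ∃ a, DegLE D a ∧ wn a ≤ κ * wn p ∧ shift α a = a - p := by
  refine ⟨mult (fun m => if m = 0 then 0 else -(phase α m - 1)⁻¹) p, hp.mult _,
    wn_mult_le hκ hp fun m hm => ?_, ?_⟩
  · split_ifs with h0
    · simpa using hκ
    · rw [norm_neg, norm_inv, inv_eq_one_div, div_le_iff₀]
      · exact h m h0 hm
      · have := h m h0 hm
        by_contra hn
        have h1 : ‖phase α m - 1‖ = 0 := le_antisymm (not_lt.1 hn) (norm_nonneg _)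
        rw [h1] at this; linarith
  · ext m
    rw [coeff_shift', coeff_sub, Finsupp.sub_apply, coeff_mult]
    by_cases hm : p.coeff m = 0
    · simp [hm]
    · have h0 : m ≠ 0 := fun h => hm (h ▸ hp0)
      have h1 : phase α m - 1 ≠ 0 := fun h1 => by
        have := h m h0 (hp m hm); rw [h1, norm_zero] at this; linarith
      rw [if_neg h0]
      field_simp
      ring

/-- Solution of `wSb = b + q`. -/
theorem exists_mul_shift_eq_add {α κ : ℝ} {w : ℂ} {D : ℕ} (hκ : 0 ≤ κ)
    (h : ∀ m : ℤ, m.natAbs ≤ D → 1 ≤ κ * ‖w * phase α m - 1‖)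
    {q : TrigPoly} (hq : DegLE D q) :
    ∃ b, DegLE D b ∧ wn b ≤ κ * wn q ∧ algebraMap ℂ TrigPoly w * shift α b = b + q := by
  have h0 : ∀ m : ℤ, m.natAbs ≤ D → w * phase α m - 1 ≠ 0 := fun m hm h1 => by
    have := h m hm; rw [h1, norm_zero] at this; linarith
  refine ⟨mult (fun m => (w * phase α m - 1)⁻¹) q, hq.mult _,
    wn_mult_le hκ hq fun m hm => ?_, ?_⟩
  · rw [norm_inv, inv_eq_one_div, div_le_iff₀ (norm_pos_iff.2 (h0 m hm))]
    exact h m hm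
  · ext m
    rw [coeff_algebraMap_mul, coeff_shift', coeff_add, Finsupp.add_apply, coeff_mult]
    by_cases hm : q.coeff m = 0
    · simp [hm]
    · have h1 := h0 m (hq m hm)
      field_simp
      ring

theorem wn_sub_mean_le {α κ : ℝ} {D : ℕ} (hκ : 0 ≤ κ)
    (h : ∀ m : ℤ, m ≠ 0 → m.natAbs ≤ D → 1 ≤ κ * ‖phase α m - 1‖)
    {p : TrigPoly} (hp : DegLE D p) :
    wn (p - algebraMap ℂ TrigPoly (p.coeff 0)) ≤ κ * wn (p - shift (-α) p) := by
  refine wn_le_of_coeff_le hκ fun m hm => ?_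
  have h0 : m ≠ 0 := by
    rintro rfl
    rw [coeff_sub, Finsupp.sub_apply, coeff_algebraMap_zero, sub_self] at hm
    exact hm rfl
  rw [coeff_sub, Finsupp.sub_apply, coeff_algebraMap_of_ne h0, sub_zero] at hm ⊢
  rw [coeff_sub, Finsupp.sub_apply, coeff_shift', phase_neg_left,
    show p.coeff m - p.coeff m * phase α (-m) = -(p.coeff m * (phase α (-m) - 1)) by ring,
    norm_neg, norm_mul]
  have := mul_le_mul_of_nonneg_left (h (-m) (neg_ne_zero.2 h0) (by simpa using hp m hm))
    (norm_nonneg (p.coeff m))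
  linarith

theorem wn_one : wn 1 = 1 := by rw [one_def, wn_single, norm_one]

theorem wn_mul_sub_one_le {u v : TrigPoly} {ν : ℝ} (hu : wn (u - 1) ≤ ν) (hv : wn (v - 1) ≤ ν) :
    wn (u * v - 1) ≤ 2 * ν + ν ^ 2 := by
  rw [show u * v - 1 = (u - 1) + (v - 1) + (u - 1) * (v - 1) by ring]
  linarith [wn_add (u - 1 + (v - 1)) ((u - 1) * (v - 1)), wn_add (u - 1) (v - 1),
    wn_mul_le hu hv]

theorem coeff_sub_one_zero (u : TrigPoly) : (u - 1).coeff 0 = u.coeff 0 - 1 := by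
  rw [coeff_sub, Finsupp.sub_apply, one_def, coeff_single, Finsupp.single_eq_same]

theorem coeff_cj_mul_zero_real {e u : TrigPoly} (h : (u * cj e).coeff 0 = (cj u * e).coeff 0) :
    ((e * cj u).coeff 0).im = 0 := by
  have h1 : conj ((e * cj u).coeff 0) = (e * cj u).coeff 0 := by
    have := coeff_cj (e * cj u) 0
    rw [neg_zero, map_mul, cj_cj, mul_comm (cj e), h, mul_comm (cj u)] at this
    exact this.symm
  exact Complex.conj_eq_iff_im.1 h1

theorem newton_step {α : ℝ} {z : ℂ} {V u : TrigPoly} {E ν κ c0 δ : ℝ} {D : ℕ}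
    (hz : ‖z‖ = 1) (hV : cj V = V) (hVD : DegLE D V) (huD : DegLE D u)
    (hu : wn (u - 1) ≤ ν) (hν : ν ≤ c0 / 100) (hc0 : 0 < c0) (hc : c0 ≤ ‖z ^ 2 - 1‖)
    (hκ : 1 ≤ κ)
    (hκ1 : ∀ m : ℤ, m ≠ 0 → m.natAbs ≤ 3 * D → 1 ≤ κ * ‖phase α m - 1‖)
    (hκ2 : ∀ m : ℤ, m.natAbs ≤ 3 * D → 1 ≤ κ * ‖z ^ 2 * phase α m - 1‖)
    (he : wn (defect α z V u E) ≤ δ) :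
    ∃ y E', DegLE (4 * D) y ∧ wn y ≤ 240 * κ * δ / c0 ∧
      wn (defect α z V (u + y) (E + E')) ≤ 240 * κ * δ ^ 2 / c0 := by
  set e := defect α z V u E with he_def
  have hc2 : c0 ≤ 2 := hc.trans ((norm_sub_le _ _).trans (by rw [norm_pow, hz, norm_one]; norm_num))
  have hν0 : 0 ≤ ν := (wn_nonneg _).trans hu
  have hδ0 : 0 ≤ δ := (wn_nonneg _).trans he
  have hub : wn (cj u - 1) ≤ ν := by
    rw [← map_one cj, ← map_sub, wn_cj]; exact hu
  have hSu : wn (shift α u - 1) ≤ ν := by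
    rw [← map_one (shift α), ← map_sub, wn_shift]; exact hu
  have hSub : wn (shift α (cj u) - 1) ≤ ν := by
    rw [← map_one (shift α), ← map_sub, wn_shift]; exact hub
  have hu1 : wn u ≤ 1.02 := by
    have := wn_add (u - 1) 1
    rw [sub_add_cancel, wn_one] at this; linarith
  have hub1 : wn (cj u) ≤ 1.02 := by rwa [wn_cj]
  have heb : wn (cj e) ≤ δ := by rwa [wn_cj]
  have hν2 : 2 * ν + ν ^ 2 ≤ 2.02 * ν := by nlinarith
  -- degrees
  have heD : DegLE (2 * D) e := by
    rw [he_def, defect, two_mul]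
    refine DegLE.add (DegLE.add ?_ ?_) (DegLE.mul (hVD.sub (degLE_algebraMap _ _)) huD)
    · exact ((huD.shift _).algebraMap_mul _).mono (by omega)
    · exact ((huD.shift _).algebraMap_mul _).mono (by omega)
  -- the normalization
  set N := (u * cj u).coeff 0 with hN
  have hN1 : ‖N - 1‖ ≤ 1 / 10 := by
    rw [hN, ← coeff_sub_one_zero]
    exact (norm_coeff_le_wn _ _).trans ((wn_mul_sub_one_le hu hub).trans (by linarith))
  have hNim : N.im = 0 := coeff_cj_mul_zero_real (by rw [mul_comm])
  have hN9 : 9 / 10 ≤ ‖N‖ := by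
    have := norm_sub_norm_le (1 : ℂ) (1 - N)
    rw [sub_sub_cancel, norm_sub_rev 1 N, norm_one] at this; linarith
  have hN0 : N ≠ 0 := norm_pos_iff.1 (by linarith)
  set ω := wronskian α z u with hω
  have hωS := wronskian_sub_shift α z V u E hV
  rw [← he_def, ← hω] at hωS
  have hωD : DegLE (3 * D) ω := by
    rw [hω, wronskian]
    refine DegLE.mono (D := D + D) ?_ (by omega)
    exact ((huD.mul (huD.cj.shift _)).algebraMap_mul _).sub
      (((huD.shift _).mul huD.cj).algebraMap_mul _)
  set M := (e * cj u).coeff 0 with hM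
  have hMim : M.im = 0 := coeff_cj_mul_zero_real (by
    have := congrArg (fun p : TrigPoly => p.coeff 0) hωS
    simp only [coeff_sub, Finsupp.sub_apply, coeff_shift', phase_zero, mul_one, sub_self] at this
    exact (sub_eq_zero.1 this.symm))
  have hMn : ‖M‖ ≤ 1.02 * δ := (norm_coeff_le_wn _ _).trans
    ((wn_mul_le he hub1).trans (by linarith))
  set E' : ℝ := (M / N).re with hE'
  have hE'c : (E' : ℂ) = M / N := by
    refine Complex.ext (Complex.ofReal_re _) ?_
    rw [Complex.ofReal_im, Complex.div_im, hMim, hNim]; ring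
  have hE'n : |E'| ≤ 1.2 * δ := by
    rw [← Real.norm_eq_abs, ← Complex.norm_real, hE'c, norm_div, div_le_iff₀ (by linarith)]
    nlinarith
  -- the mean of the Wronskian
  set w0 := ω.coeff 0 with hw0
  have hw : c0 / 2 ≤ ‖w0‖ := by
    have h1 : ‖w0 - (conj z - z)‖ ≤ 4.04 * ν := by
      have : ω - algebraMap ℂ TrigPoly (conj z - z) =
          algebraMap ℂ TrigPoly (conj z) * (u * shift α (cj u) - 1) -
          algebraMap ℂ TrigPoly z * (shift α u * cj u - 1) := by
        rw [hω, wronskian, map_sub]; ring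
      have h2 : w0 - (conj z - z) = (ω - algebraMap ℂ TrigPoly (conj z - z)).coeff 0 := by
        rw [coeff_sub, Finsupp.sub_apply, coeff_algebraMap_zero]
      rw [h2, this]
      refine (norm_coeff_le_wn _ _).trans ((wn_sub _ _).trans ?_)
      have h3 := wn_mul_le (wn_algebraMap (conj z)).le (wn_mul_sub_one_le hu hSub)
      have h4 := wn_mul_le (wn_algebraMap z).le (wn_mul_sub_one_le hSu hub)
      rw [RCLike.norm_conj, hz] at h3
      rw [hz] at h4
      linarith
    have h2 : ‖conj z - z‖ = ‖z ^ 2 - 1‖ := by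
      have : conj z - z = - (conj z * (z ^ 2 - 1)) := by
        have : conj z * z = 1 := by rw [Complex.conj_mul', hz]; simp
        linear_combination z * this
      rw [this, norm_neg, norm_mul, RCLike.norm_conj, hz, one_mul]
    have := norm_sub_norm_le (conj z - z) ((conj z - z) - w0)
    rw [sub_sub_cancel, norm_sub_rev _ w0] at this
    linarith
  have hw00 : w0 ≠ 0 := norm_pos_iff.1 (by linarith)
  have hwi : ‖w0⁻¹‖ ≤ 2 / c0 := by
    rw [norm_inv, inv_eq_one_div, div_le_div_iff₀ (by linarith) hc0]; linarith
  -- the right-hand side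
  set f := algebraMap ℂ TrigPoly E' * u - e with hf
  have hfn : wn f ≤ 3 * δ := by
    refine (wn_sub _ _).trans ?_
    have := wn_mul_le (wn_algebraMap (E' : ℂ)).le hu1
    rw [Complex.norm_real, Real.norm_eq_abs] at this
    linarith
  have hfD : DegLE (2 * D) f := ((huD.algebraMap_mul _).mono (by omega)).sub heD
  have hf0 : (f * cj u).coeff 0 = 0 := by
    rw [hf, sub_mul, coeff_sub, Finsupp.sub_apply, mul_assoc, coeff_algebraMap_mul, hE'c, ← hN,
      ← hM, div_mul_cancel₀ _ hN0, sub_self]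
  have hWn : wn (algebraMap ℂ TrigPoly w0⁻¹) ≤ 2 / c0 := by rwa [wn_algebraMap]
  have hκ0 : 0 ≤ κ := by linarith
  obtain ⟨a, haD, han, ha⟩ := exists_shift_eq_sub hκ0 hκ1
    (p := algebraMap ℂ TrigPoly w0⁻¹ * (f * cj u))
    ((((hfD.mul huD.cj).algebraMap_mul _).mono (by omega)))
    (by rw [coeff_algebraMap_mul, hf0, mul_zero])
  obtain ⟨b, hbD, hbn, hb⟩ := exists_mul_shift_eq_add hκ0 hκ2
    (q := algebraMap ℂ TrigPoly w0⁻¹ * (f * u))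
    ((((hfD.mul huD).algebraMap_mul _).mono (by omega)))
  have key := defect_newton (E' := E') hV hz hf ha hb
  have hc0i : 0 < 1 / c0 := by positivity
  have han' : wn a ≤ 7 * κ * δ / c0 := by
    refine han.trans ?_
    have := wn_mul_le hWn (wn_mul_le hfn hub1)
    calc κ * _ ≤ κ * (2 / c0 * (3 * δ * 1.02)) := by gcongr
      _ = 6.12 * (κ * δ / c0) := by ring
      _ ≤ 7 * (κ * δ / c0) := by gcongr; norm_num
      _ = _ := by ring
  have hbn' : wn b ≤ 7 * κ * δ / c0 := by
    refine hbn.trans ?_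
    have := wn_mul_le hWn (wn_mul_le hfn hu1)
    calc κ * _ ≤ κ * (2 / c0 * (3 * δ * 1.02)) := by gcongr
      _ = 6.12 * (κ * δ / c0) := by ring
      _ ≤ 7 * (κ * δ / c0) := by gcongr; norm_num
      _ = _ := by ring
  have hyn : wn (a * u + b * cj u) ≤ 15 * κ * δ / c0 := by
    refine (wn_add _ _).trans ((add_le_add (wn_mul_le han' hu1) (wn_mul_le hbn' hub1)).trans ?_)
    have : 0 ≤ κ * δ / c0 := by positivity
    linear_combination 0.72 * this
  refine ⟨a * u + b * cj u, E', ?_, hyn.trans ?_, ?_⟩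
  · exact ((haD.mul huD).add (hbD.mul huD.cj)).mono (by omega)
  · have : 0 ≤ κ * δ / c0 := by positivity
    linear_combination 225 * this
  rw [key]
  have hωn : wn (algebraMap ℂ TrigPoly w0⁻¹ * ω - 1) ≤ 8 * κ * δ / c0 := by
    have h1 : algebraMap ℂ TrigPoly w0⁻¹ * ω - 1 =
        algebraMap ℂ TrigPoly w0⁻¹ * (ω - algebraMap ℂ TrigPoly w0) := by
      rw [mul_sub, ← map_mul, inv_mul_cancel₀ hw00, map_one]
    have h2 : wn (ω - algebraMap ℂ TrigPoly w0) ≤ 4 * κ * δ := by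
      refine (wn_sub_mean_le hκ0 hκ1 hωD).trans ?_
      rw [hωS]
      have h3 := (wn_sub (u * cj e) (cj u * e)).trans
        (add_le_add (wn_mul_le hu1 heb) (wn_mul_le hub1 he))
      have : 0 ≤ κ * δ := by positivity
      calc κ * _ ≤ κ * (1.02 * δ + 1.02 * δ) := by gcongr
        _ ≤ 4 * κ * δ := by linarith
    rw [h1]
    refine (wn_mul_le hWn h2).trans (le_of_eq (by ring))
  have h1 := wn_mul_le hfn hωn
  have h2 := wn_mul_le han' he
  have h3 := wn_mul_le hbn' heb
  have h4 := wn_mul_le (wn_algebraMap (E' : ℂ)).le hyn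
  rw [Complex.norm_real, Real.norm_eq_abs] at h4
  have h4' : |E'| * (15 * κ * δ / c0) ≤ 1.2 * δ * (15 * κ * δ / c0) := by gcongr
  have h5 := wn_sub (f * (algebraMap ℂ TrigPoly w0⁻¹ * ω - 1) + a * e + b * cj e)
    (algebraMap ℂ TrigPoly E' * (a * u + b * cj u))
  have h6 := wn_add (f * (algebraMap ℂ TrigPoly w0⁻¹ * ω - 1) + a * e) (b * cj e)
  have h7 := wn_add (f * (algebraMap ℂ TrigPoly w0⁻¹ * ω - 1)) (a * e)
  refine h5.trans (((add_le_add (h6.trans (add_le_add (h7.trans (add_le_add h1 h2)) h3))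
    (h4.trans h4'))).trans ?_)
  have : 0 ≤ κ * δ ^ 2 / c0 := by positivity
  linear_combination 184 * this

/-- Small divisor estimates up to frequency `3L`. -/
def SmallDivisors (α : ℝ) (z : ℂ) (A : ℝ) (T L : ℕ) : Prop :=
  ∀ D : ℕ, 1 ≤ D → D ≤ L → ∀ m : ℤ, m.natAbs ≤ 3 * D →
    (m ≠ 0 → 1 ≤ A * (4 * D : ℝ) ^ T * ‖phase α m - 1‖) ∧
    1 ≤ A * (4 * D : ℝ) ^ T * ‖z ^ 2 * phase α m - 1‖

theorem newton_iterate {α : ℝ} {z : ℂ} {V u : TrigPoly} {E ν c0 A X : ℝ} {D T L : ℕ}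
    (hz : ‖z‖ = 1) (hV : cj V = V) (hVD : DegLE D V) (huD : DegLE D u) (hD : 1 ≤ D)
    (hu : wn (u - 1) ≤ ν) (hν : ν + 2 * X ≤ c0 / 100) (hc0 : 0 < c0) (hc : c0 ≤ ‖z ^ 2 - 1‖)
    (hA : 1 ≤ A) (hdiv : SmallDivisors α z A T L) (hX0 : 0 ≤ X) (hX : X ≤ 1 / 2)
    (he : 240 * A / c0 * (16 * D : ℝ) ^ T * wn (defect α z V u E) ≤ X) (n : ℕ)
    (hn : 4 ^ n * D ≤ L) :
    ∃ u' E', DegLE (4 ^ n * D) u' ∧ wn (u' - 1) ≤ ν + 2 * X - 2 * X ^ (2 ^ n) ∧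
      240 * A / c0 * (16 * (4 ^ n * D : ℕ) : ℝ) ^ T * wn (defect α z V u' E') ≤ X ^ (2 ^ n) := by
  induction n with
  | zero => exact ⟨u, E, by simpa using huD, by simpa using hu, by simpa using he⟩
  | succ n ih =>
    have hn' : 4 ^ n * D ≤ L := le_trans (by rw [pow_succ]; nlinarith [Nat.zero_le (4 ^ n * D)]) hn
    obtain ⟨u', E', hD', hu', he'⟩ := ih hn'
    have hDn : 1 ≤ 4 ^ n * D := Nat.mul_pos (by positivity) hD
    have hDr : (1 : ℝ) ≤ (4 ^ n * D : ℕ) := by exact_mod_cast hDn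
    set D' := 4 ^ n * D with hD'def
    set δ := wn (defect α z V u' E') with hδ
    have hδ0 : 0 ≤ δ := wn_nonneg _
    set x := X ^ (2 ^ n) with hx
    have hx0 : 0 ≤ x := by positivity
    have hx2 : x ≤ 1 / 2 := by
      refine (pow_le_pow_left₀ hX0 hX _).trans ?_
      exact (pow_le_pow_of_le_one (by norm_num) (by norm_num) (Nat.one_le_two_pow)).trans
        (by norm_num)
    have hκ : 1 ≤ A * (4 * D' : ℝ) ^ T :=
      one_le_mul_of_one_le_of_one_le hA (one_le_pow₀ (by linarith))
    obtain ⟨y, E'', hyD, hyn, hye⟩ := newton_step (V := V) (u := u') (E := E') (D := D') (δ := δ)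
      (ν := ν + 2 * X - 2 * x) hz hV
      (hVD.mono (Nat.le_mul_of_pos_left _ (by positivity))) hD' hu' (by linarith) hc0 hc hκ
      (fun m hm hmD => (hdiv D' hDn hn' m hmD).1 hm) (fun m hmD => (hdiv D' hDn hn' m hmD).2) le_rfl
    have h4 : (4 * D' : ℝ) ^ T ≤ (16 * D' : ℝ) ^ T := by gcongr; norm_num
    have hyx : wn y ≤ x := by
      refine hyn.trans (le_trans ?_ he')
      calc 240 * (A * (4 * D' : ℝ) ^ T) * δ / c0 = 240 * A / c0 * (4 * D' : ℝ) ^ T * δ := by ring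
        _ ≤ _ := by gcongr
    refine ⟨u' + y, E' + E'', ?_, ?_, ?_⟩
    · rw [show 4 ^ (n + 1) * D = 4 * D' by rw [hD'def]; ring]
      exact (hD'.mono (by omega)).add hyD
    · rw [show X ^ 2 ^ (n + 1) = x ^ 2 by rw [hx, ← pow_mul, ← pow_succ],
        show u' + y - 1 = (u' - 1) + y by ring]
      have := wn_add (u' - 1) y
      nlinarith
    · rw [show X ^ 2 ^ (n + 1) = x ^ 2 by rw [hx, ← pow_mul, ← pow_succ],
        show 4 ^ (n + 1) * D = 4 ^ n * 4 * D by rw [pow_succ]]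
      have h5 : (16 * (4 ^ n * 4 * D : ℕ) : ℝ) ^ T * (4 * D' : ℝ) ^ T =
          ((16 * D' : ℝ) ^ T) ^ 2 := by
        rw [← mul_pow, ← pow_mul, mul_comm T 2, pow_mul]
        congr 1
        rw [hD'def]; push_cast; ring
      calc _ ≤ 240 * A / c0 * (16 * (4 ^ n * 4 * D : ℕ) : ℝ) ^ T *
            (240 * (A * (4 * D' : ℝ) ^ T) * δ ^ 2 / c0) := by gcongr
        _ = (240 * A / c0) ^ 2 *
            ((16 * (4 ^ n * 4 * D : ℕ) : ℝ) ^ T * (4 * D' : ℝ) ^ T) * δ ^ 2 := by ring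
        _ = (240 * A / c0 * (16 * D' : ℝ) ^ T * δ) ^ 2 := by rw [h5]; ring
        _ ≤ x ^ 2 := by gcongr

/-- The trigonometric polynomial `b cos(mθ)`. -/
noncomputable def cosMon (b : ℝ) (m : ℕ) : TrigPoly :=
  single (m : ℤ) (b / 2 : ℂ) + single (-(m : ℤ)) (b / 2 : ℂ)

theorem cj_cosMon (b : ℝ) (m : ℕ) : cj (cosMon b m) = cosMon b m := by
  rw [cosMon, map_add, cj_single, cj_single, neg_neg, add_comm]
  simp only [map_div₀, Complex.conj_ofReal, map_ofNat]

theorem wn_cosMon_le (b : ℝ) (m : ℕ) : wn (cosMon b m) ≤ |b| := by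
  refine (wn_add _ _).trans (le_of_eq ?_)
  rw [wn_single, wn_single, norm_div, Complex.norm_real, Real.norm_eq_abs]
  norm_num

theorem degLE_cosMon (b : ℝ) (m : ℕ) : DegLE m (cosMon b m) :=
  (DegLE.single (by simp) _).add (DegLE.single (by simp) _)

theorem ev_cosMon (b x : ℝ) (m : ℕ) : ev x (cosMon b m) = (b * Real.cos (m * x) : ℝ) := by
  rw [cosMon, map_add, ev_single, ev_single]
  push_cast
  rw [Complex.cos, mul_neg, neg_mul, mul_comm (m : ℂ) x, neg_mul]
  ring

theorem defect_one (α : ℝ) {z : ℂ} : defect α z 0 1 (2 * z.re) = 0 := by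
  rw [defect, map_one, map_one, mul_one, mul_one, mul_one, zero_sub, ← map_add, ← sub_eq_add_neg,
    ← map_sub, Complex.add_conj]
  simp

theorem defect_add_potential (α : ℝ) (z : ℂ) (V W u : TrigPoly) (E : ℝ) :
    defect α z (V + W) u E = defect α z V u E + W * u := by
  rw [defect, defect]; ring

/-- The growth conditions on the frequencies `m i` under which the construction runs:
`ε i` is the size of the `i`-th mode, `X i` bounds the corrections at stage `i`, `L i` is the range
of frequencies at which the small divisors are controlled. -/
structure Scales (A c0 ν η : ℝ) (T : ℕ) (m L : ℕ → ℕ) (ε X : ℕ → ℝ) : Prop where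
  one_le : ∀ i, 1 ≤ m i
  pos : ∀ i, 0 < ε i
  le_X : ∀ i, 240 * A / c0 * (16 * m i : ℝ) ^ T * (2 * ε i) ≤ X i
  X_succ : ∀ i, X (i + 1) ≤ X i / 2
  X_zero : 4 * X 0 ≤ ν
  exists_steps : ∀ i, ∃ n, 4 ^ n * m i ≤ L (i + 1) ∧ X i ^ (2 ^ n) ≤ η * ε (i + 1)
  mono : Monotone L
  le_m : ∀ i, L i ≤ m i

theorem exists_approx_eigenfunction {α : ℝ} {z : ℂ} {A c0 ν η lam : ℝ} {T : ℕ} {m L : ℕ → ℕ}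
    {ε X : ℕ → ℝ} (hS : Scales A c0 ν η T m L ε X) (hz : ‖z‖ = 1) (hc0 : 0 < c0)
    (hc : c0 ≤ ‖z ^ 2 - 1‖) (hA : 1 ≤ A) (hν : ν ≤ c0 / 100) (hη : 0 ≤ η) (hη1 : η ≤ 1 / 2)
    (hlam : |lam| ≤ 1) {j : ℕ} (hdiv : SmallDivisors α z A T (L j)) (i : ℕ) (hi : i ≤ j) :
    ∃ u E, DegLE (m i) u ∧ wn (u - 1) ≤ ν - 4 * X i ∧
      wn (defect α z (∑ l ∈ Finset.range i, cosMon (lam * ε l) (m l)) u E) ≤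
        |lam| * (η * ε i) := by
  have hc2 : c0 ≤ 2 := hc.trans ((norm_sub_le _ _).trans (by rw [norm_pow, hz, norm_one]; norm_num))
  have hpre : ∀ k : ℕ, 1 ≤ k → 1 ≤ 240 * A / c0 * (16 * k : ℝ) ^ T := fun k hk => by
    have hk' : (1 : ℝ) ≤ k := by exact_mod_cast hk
    refine one_le_mul_of_one_le_of_one_le ?_ (one_le_pow₀ (by linarith))
    rw [one_le_div hc0]; linarith
  have hX0 : ∀ i, 0 < X i := fun i => lt_of_lt_of_le (by
    have := hS.pos i; have := hpre _ (hS.one_le i); positivity) (hS.le_X i)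
  have hX4 : ∀ i, 4 * X i ≤ ν := fun i => by
    induction i with
    | zero => exact hS.X_zero
    | succ i ih => linarith [hS.X_succ i, hX0 i]
  have hm : ∀ i, m i ≤ m (i + 1) := fun i => by
    obtain ⟨n, hn, -⟩ := hS.exists_steps i
    exact (Nat.le_mul_of_pos_left _ (by positivity)).trans (hn.trans (hS.le_m _))
  have hmm : Monotone m := monotone_nat_of_le_succ hm
  induction i with
  | zero =>
    refine ⟨1, 2 * z.re, ?_, ?_, ?_⟩
    · rw [← map_one (algebraMap ℂ TrigPoly)]; exact degLE_algebraMap _ _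
    · rw [sub_self, wn_zero]; linarith [hS.X_zero]
    · rw [Finset.range_zero, Finset.sum_empty, defect_one, wn_zero]
      have := hS.pos 0
      positivity
  | succ i ih =>
    obtain ⟨u, E, huD, hu, he⟩ := ih (by omega)
    obtain ⟨n, hn, hXn⟩ := hS.exists_steps i
    have hnm := hS.le_m (i + 1)
    have hε := hS.pos i
    have hXi := hX0 i
    have hXi4 := hX4 i
    have hu1 : wn u ≤ 2 := by
      have := wn_add (u - 1) 1
      rw [sub_add_cancel, wn_one] at this; linarith
    have hu1' : wn u ≤ 1.5 := by
      have := wn_add (u - 1) 1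
      rw [sub_add_cancel, wn_one] at this; linarith
    have hV : cj (∑ l ∈ Finset.range (i + 1), cosMon (lam * ε l) (m l)) =
        ∑ l ∈ Finset.range (i + 1), cosMon (lam * ε l) (m l) := by
      rw [map_sum]; simp only [cj_cosMon]
    have hVD : DegLE (m i) (∑ l ∈ Finset.range (i + 1), cosMon (lam * ε l) (m l)) := by
      refine Finset.sum_induction _ (DegLE (m i)) (fun _ _ => DegLE.add)
        (fun _ h => absurd rfl h) fun l hl => (degLE_cosMon _ _).mono (hmm ?_)
      exact Nat.lt_succ_iff.1 (Finset.mem_range.1 hl)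
    have he' : wn (defect α z (∑ l ∈ Finset.range (i + 1), cosMon (lam * ε l) (m l)) u E) ≤
        |lam| * (2 * ε i) := by
      rw [Finset.sum_range_succ, defect_add_potential]
      refine (wn_add _ _).trans ((add_le_add he (wn_mul_le (wn_cosMon_le _ _) hu1')).trans ?_)
      rw [abs_mul, abs_of_pos hε]
      have h1 : |lam| * (η * ε i) ≤ |lam| * (1 / 2 * ε i) := by gcongr
      linarith
    have hd : SmallDivisors α z A T (L (i + 1)) := fun D h1 hD => hdiv D h1 (hD.trans (hS.mono hi))
    have hlX : |lam| * X i ≤ X i := mul_le_of_le_one_left hXi.le hlam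
    obtain ⟨u', E', hD', hu', hE'⟩ := newton_iterate (ν := ν - 4 * X i) (X := |lam| * X i) hz hV hVD
      huD (hS.one_le i) hu (by linarith) hc0 hc hA hd (by positivity) (by linarith) (by
        have := hpre _ (hS.one_le i)
        calc _ ≤ 240 * A / c0 * (16 * m i : ℝ) ^ T * (|lam| * (2 * ε i)) := by gcongr
          _ = |lam| * (240 * A / c0 * (16 * m i : ℝ) ^ T * (2 * ε i)) := by ring
          _ ≤ _ := by gcongr; exact hS.le_X i) n hn
    refine ⟨u', E', hD'.mono (hn.trans hnm), ?_, ?_⟩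
    · have : 0 ≤ (|lam| * X i) ^ 2 ^ n := by positivity
      linarith [hS.X_succ i]
    · have h1 := hpre (4 ^ n * m i) (Nat.mul_pos (by positivity) (hS.one_le i))
      calc wn _ ≤ 240 * A / c0 * (16 * (4 ^ n * m i : ℕ) : ℝ) ^ T * wn _ :=
            le_mul_of_one_le_left (wn_nonneg _) h1
        _ ≤ (|lam| * X i) ^ 2 ^ n := hE'
        _ = |lam| ^ 2 ^ n * X i ^ 2 ^ n := mul_pow _ _ _
        _ ≤ |lam| * (η * ε (i + 1)) := by
          have : |lam| ^ 2 ^ n ≤ |lam| := pow_le_of_le_one (abs_nonneg _) hlam (by positivity)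
          gcongr

theorem norm_sq_sub_one {z : ℂ} (hz : ‖z‖ = 1) : ‖z ^ 2 - 1‖ = 2 * |z.im| := by
  have h1 : z * conj z = 1 := by rw [Complex.mul_conj', hz]; simp
  have h2 : z ^ 2 - 1 = z * (z - conj z) := by linear_combination h1
  rw [h2, Complex.sub_conj, norm_mul, hz, norm_mul, Complex.norm_I, Complex.norm_real,
    Real.norm_eq_abs, abs_mul, abs_two]
  ring

theorem ev_defect (α : ℝ) (z : ℂ) (V u : TrigPoly) (E x : ℝ) :
    ev x (defect α z V u E) = z * ev (x + α) u + conj z * ev (x - α) u + (ev x V - E) * ev x u := by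
  simp only [defect, map_add, map_mul, map_sub, AlgHom.commutes, ev_shift, ← sub_eq_add_neg]
  rfl

/-- The gap attached to the `j`-th mode. -/
theorem exists_gap_of_scales {α A c0 ν η lam x0 : ℝ} {T : ℕ} {m L : ℕ → ℕ}
    {ε X : ℕ → ℝ} (hS : Scales A c0 ν η T m L ε X) (hc0 : 0 < c0)
    (hA : 1 ≤ A) (hν : ν ≤ c0 / 4000) (hη : 0 ≤ η) (hη1 : η ≤ 1 / 1000)
    (hlam0 : 0 < |lam|) (hlam : |lam| ≤ 1) (hε : Summable ε) (j : ℕ)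
    (htail : ∑' i, ε (i + (j + 1)) ≤ ε j / 1000)
    (hc : c0 ≤ ‖phase α (m j) - 1‖) (hc' : c0 ≤ ‖phase α (2 * m j) - 1‖)
    (hdiv : ∀ z : ℂ, z ^ 2 = phase α (m j) → SmallDivisors α z A T (L j))
    (H : lp (fun _ : ℤ => ℝ) 2 →L[ℝ] lp (fun _ : ℤ => ℝ) 2)
    (hH : ∀ u : lp (fun _ : ℤ => ℝ) 2, ∀ n : ℤ, H u n = u (n + 1) + u (n - 1) +
      lam * (∑' i, ε i * Real.cos (m i * (x0 + n * α))) * u n) :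
    ∃ Em ∈ spectrum ℝ H, ∃ Ep ∈ spectrum ℝ H, Set.Ioo Em Ep ⊆ (spectrum ℝ H)ᶜ ∧
      |lam| * ε j / 10 ≤ Ep - Em ∧ Ep - Em ≤ 12 * (|lam| * ε j) := by
  set z : ℂ := Complex.exp ((m j * α / 2 : ℝ) * Complex.I) with hzdef
  have hz : ‖z‖ = 1 := Complex.norm_exp_ofReal_mul_I _
  have hz2 : z ^ 2 = phase α (m j) := by
    rw [hzdef, ← Complex.exp_nat_mul, phase]; congr 1; push_cast; ring
  have hz4 : (z ^ 2) ^ 2 = phase α (2 * m j) := by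
    rw [hz2, phase, phase, ← Complex.exp_nat_mul]; congr 1; push_cast; ring
  rw [← hz2] at hc
  rw [← hz4] at hc'
  have hzim : c0 / 2 ≤ |z.im| := by rw [norm_sq_sub_one hz] at hc; linarith
  have hεj := hS.pos j
  have hX4 : ∀ i, 4 * X i ≤ ν := fun i => by
    have hX0 : ∀ i, 0 ≤ X i := fun i => le_trans (by have := hS.pos i; positivity) (hS.le_X i)
    induction i with
    | zero => exact hS.X_zero
    | succ i ih => linarith [hS.X_succ i, hX0 i]
  have hX0 : 0 ≤ X j := le_trans (by positivity) (hS.le_X j)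
  obtain ⟨u, E, huD, hu, he⟩ := exists_approx_eigenfunction (lam := lam) hS hz hc0 hc hA
    (by linarith) hη (by linarith) hlam (hdiv z hz2) j le_rfl
  have hεc : ε j ≤ c0 ^ 2 / 400 := by
    have h1 : (1 : ℝ) ≤ (16 * m j : ℝ) ^ T := one_le_pow₀ (by
      have : (1 : ℝ) ≤ m j := by exact_mod_cast hS.one_le j
      linarith)
    have h2 : 240 * 1 / c0 * 1 * (2 * ε j) ≤ 240 * A / c0 * (16 * m j : ℝ) ^ T * (2 * ε j) := by
      gcongr
    have h3 := hX4 j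
    have h4 : 480 * ε j / c0 ≤ c0 / 16000 :=
      calc 480 * ε j / c0 = 240 * 1 / c0 * 1 * (2 * ε j) := by ring
        _ ≤ X j := h2.trans (hS.le_X j)
        _ ≤ _ := by linarith
    rw [div_le_iff₀ hc0] at h4
    nlinarith
  set x : ℤ → ℝ := fun n => x0 + n * α with hx
  set W : TrigPoly := ∑ l ∈ Finset.range j, cosMon (lam * ε l) (m l) with hW
  set g : ℤ → ℂ := fun n => Complex.exp ((m j * x n / 2 : ℝ) * Complex.I) with hg
  have hgs : ∀ n, g (n + 1) = z * g n := fun n => by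
    simp only [hg, hzdef, hx]; rw [← Complex.exp_add]; congr 1; push_cast; ring
  have hgp : ∀ n, g (n - 1) = conj z * g n := fun n => by
    have h1 := hgs (n - 1)
    rw [sub_add_cancel] at h1
    rw [h1, ← mul_assoc, Complex.conj_mul', hz]; simp
  have hg1 : ∀ n, ‖g n‖ = 1 := fun n => Complex.norm_exp_ofReal_mul_I _
  have hWev : ∀ n, ev (x n) W = (lam * ∑ l ∈ Finset.range j, ε l * Real.cos (m l * x n) : ℝ) :=
    fun n => by
      rw [hW, map_sum, Finset.mul_sum]
      push_cast [ev_cosMon]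
      exact Finset.sum_congr rfl fun l _ => by ring
  have hsum : ∀ y : ℝ, Summable fun i => ε i * Real.cos (m i * y) := fun y =>
    Summable.of_norm_bounded hε fun i => by
      rw [Real.norm_eq_abs, abs_mul, abs_of_pos (hS.pos i)]
      exact mul_le_of_le_one_right (hS.pos i).le (Real.abs_cos_le_one _)
  refine exists_gap_of_approx_solution H g (fun n => Complex.exp ((m j * x n : ℝ) * Complex.I))
    (fun n => ev (x n) u) (fun n => g n * ev (x n) (defect α z W u E))
    (fun n => lam * ∑ l ∈ Finset.range j, ε l * Real.cos (m l * x n))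
    (fun n => lam * ∑' i, ε (i + (j + 1)) * Real.cos (m (i + (j + 1)) * x n)) z
    (E := E) (β := lam * ε j) (ℓ := |lam| * ε j) (b := |lam| * ε j / |z.im|) (c1 := c0) (ν := ν)
    ?_ hg1 hgs ?_ hz ?_ ?_ (by linarith) ?_ (by positivity) ?_ ?_ ?_ ?_ ?_ hc0 ?_ hc hc' 
  · intro v n
    rw [hH, ← (hsum (x n)).sum_add_tsum_nat_add (j + 1), Finset.sum_range_succ,
      Complex.exp_ofReal_mul_I_re]
    ring
  · intro n
    simp only [hg]
    rw [← Complex.exp_nat_mul]; congr 1; push_cast; ring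
  · intro h; rw [h, abs_zero] at hzim; linarith
  · intro n
    rw [← map_one (ev (x n)), ← map_sub]
    exact (norm_ev_le _ _).trans (hu.trans (by linarith))
  · intro n
    have h1 : x (n + 1) = x n + α := by simp only [hx]; push_cast; ring
    have h2 : x (n - 1) = x n - α := by simp only [hx]; push_cast; ring
    rw [ev_defect, hgs, hgp, h1, h2, hWev]
    push_cast
    ring
  · rw [abs_mul, abs_of_pos hεj]
  · intro n
    rw [abs_mul, mul_div_assoc]
    gcongr
    refine le_trans ?_ htail
    rw [← Real.norm_eq_abs]
    refine tsum_of_norm_bounded ((summable_nat_add_iff (j + 1)).2 hε).hasSum fun i => ?_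
    rw [Real.norm_eq_abs, abs_mul, abs_of_pos (hS.pos _)]
    exact mul_le_of_le_one_right (hS.pos _).le (Real.abs_cos_le_one _)
  · intro n
    rw [norm_mul, hg1, one_mul]
    refine (norm_ev_le _ _).trans (he.trans ?_)
    have : η * ε j ≤ 1 / 1000 * ε j := by gcongr
    calc |lam| * (η * ε j) ≤ |lam| * (1 / 1000 * ε j) := by gcongr
      _ = _ := by ring
  · have : |z.im| ≠ 0 := by linarith
    field_simp
  · rw [div_le_iff₀ (by linarith)]
    have : |lam| * ε j ≤ ε j := mul_le_of_le_one_left hεj.le hlam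
    nlinarith
  · rw [div_le_iff₀ (by linarith)]
    have : |lam| * ε j ≤ ε j := mul_le_of_le_one_left hεj.le hlam
    nlinarith

end TrigPoly

theorem half_abs_le_norm_exp_sub_one (x : ℝ) :
    ∃ j : ℤ, |x - 2 * π * j| / 2 ≤ ‖Complex.exp (x * Complex.I) - 1‖ := by
  refine ⟨round (x / (2 * π)), ?_⟩
  set j := round (x / (2 * π))
  set y := x - 2 * π * j with hy
  have hπ := Real.pi_pos
  have hy1 : |y / 2| ≤ π / 2 := by
    have h1 := abs_sub_round (x / (2 * π))
    have h2 : y = 2 * π * (x / (2 * π) - j) := by rw [hy]; field_simp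
    rw [h2, abs_div, abs_mul, abs_of_pos (by positivity : 0 < 2 * π), abs_two]
    nlinarith
  have h3 : Complex.exp (x * Complex.I) = Complex.exp (Complex.I * y) := by
    rw [hy, ← Complex.exp_periodic.sub_int_mul_eq (n := j) (x := x * Complex.I)]
    congr 1; push_cast; ring
  rw [h3, Complex.norm_exp_I_mul_ofReal_sub_one, norm_mul, Real.norm_eq_abs, Real.norm_eq_abs,
    abs_two]
  have h4 := Real.mul_abs_le_abs_sin hy1
  have h5 : 1 / 2 ≤ 2 / π := by
    rw [div_le_div_iff₀ two_pos hπ]; linarith [Real.pi_lt_four]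
  have h6 : 1 / 2 * |y / 2| ≤ 2 / π * |y / 2| := by gcongr
  rw [abs_div, abs_two] at *
  linarith

namespace TrigPoly

theorem phase_add (α : ℝ) (m n : ℤ) : phase α (m + n) = phase α m * phase α n := by
  rw [phase, phase, phase, ← Complex.exp_add]; congr 1; push_cast; ring

theorem norm_phase_sub_phase (α : ℝ) (m n : ℤ) :
    ‖phase α m - phase α n‖ = ‖phase α (m - n) - 1‖ := by
  have : phase α m - phase α n = phase α n * (phase α (m - n) - 1) := by
    rw [mul_sub, ← phase_add, mul_one]; congr 2; ring
  rw [this, norm_mul, norm_phase, one_mul]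

theorem card_le_of_separated {Y g : ℕ} {S : Finset ℕ} (hS : S ⊆ Finset.Ico Y (2 * Y))
    (h : ∀ m ∈ S, ∀ n ∈ S, m < n → g ≤ n - m) (hg : 0 < g) : S.card ≤ Y / g + 1 := by
  have : S.card ≤ (Finset.range (Y / g + 1)).card := by
    refine Finset.card_le_card_of_injOn (fun m => (m - Y) / g) (fun m hm => ?_) ?_
    · have := Finset.mem_Ico.1 (hS hm)
      rw [Finset.coe_range, Set.mem_Iio]
      exact Nat.lt_succ_of_le (Nat.div_le_div_right (by omega))
    · have key : ∀ m ∈ S, ∀ n ∈ S, (m - Y) / g = (n - Y) / g → ¬ m < n := by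
        intro m hm n hn hmn hlt
        have h1 := h m hm n hn hlt
        have := Finset.mem_Ico.1 (hS hm)
        have h2 : (m - Y) / g + 1 ≤ (n - Y) / g := by
          rw [← Nat.add_div_right _ hg]
          exact Nat.div_le_div_right (by omega)
        omega
      intro m hm n hn hmn
      exact le_antisymm (not_lt.1 (key n hn m hm hmn.symm)) (not_lt.1 (key m hm n hn hmn))
  rwa [Finset.card_range] at this

theorem sum_inv_sq_le (N : ℕ) : ∑ k ∈ Finset.range (N + 1), 1 / ((k : ℝ) + 1) ^ 2 ≤
    2 - 1 / ((N : ℝ) + 1) := by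
  induction N with
  | zero => norm_num
  | succ N ih =>
    rw [Finset.sum_range_succ]
    push_cast
    have h : (1 : ℝ) / (N + 1 + 1) ^ 2 ≤ 1 / (N + 1) - 1 / (N + 1 + 1) := by
      rw [div_sub_div _ _ (by positivity) (by positivity), div_le_div_iff₀ (by positivity)
        (by positivity)]
      nlinarith [(Nat.cast_nonneg N : (0 : ℝ) ≤ N)]
    linarith

/-- A Diophantine lower bound for the phases. -/
def IsDioph (α c : ℝ) (t : ℕ) : Prop :=
  ∀ m : ℤ, m ≠ 0 → c ≤ |(m : ℝ)| ^ t * ‖phase α m - 1‖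

theorem le_sub_of_near {α c c' q : ℝ} {t : ℕ} (hd : IsDioph α c t) {m n : ℤ}
    (hmn : m < n) (hc' : 2 * c' * q ^ t ≤ c) (hm : ‖phase α m - 1‖ < c')
    (hn : ‖phase α n - 1‖ < c') :
    q ≤ (n - m : ℤ) := by
  have h1 : ‖phase α (n - m) - 1‖ < 2 * c' := by
    rw [← norm_phase_sub_phase]
    have := norm_sub_le (phase α n - 1) (phase α m - 1)
    rw [sub_sub_sub_cancel_right] at this
    linarith
  have h0 : (0 : ℝ) < (n - m : ℤ) := by exact_mod_cast sub_pos.2 hmn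
  have h2 := hd (n - m) (by omega)
  rw [abs_of_pos h0] at h2
  have hc'0 : 0 < 2 * c' := (norm_nonneg _).trans_lt h1
  have h3 : q ^ t < ((n - m : ℤ) : ℝ) ^ t := by
    have : ((n - m : ℤ) : ℝ) ^ t * ‖phase α (n - m) - 1‖ < ((n - m : ℤ) : ℝ) ^ t * (2 * c') := by
      gcongr
    by_contra hcon
    push Not at hcon
    nlinarith
  exact (lt_of_pow_lt_pow_left₀ t h0.le h3).le

/-- Frequencies `m` with good small divisors at `m + l`, `|l| ≤ M`. -/
structure IsGood (α c : ℝ) (T M m : ℕ) : Prop where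
  double : c ≤ ‖phase α (2 * m) - 1‖
  near : ∀ l : ℤ, l.natAbs ≤ M → c ≤ (1 + l.natAbs : ℝ) ^ T * ‖phase α (m + l) - 1‖

theorem exists_isGood {α c : ℝ} {t : ℕ} (hc : 0 < c) (hd : IsDioph α c t) {Y : ℕ} (hY : 16 ≤ Y) :
    ∃ m, Y ≤ m ∧ m < 2 * Y ∧ IsGood α (c / (2 * 16 ^ t)) (2 * t) (Y / 8) m := by
  classical
  set c' := c / (2 * 16 ^ t) with hc'
  have hc'0 : 0 < c' := by positivity
  set I := Finset.Ico Y (2 * Y) with hI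
  set B0 := I.filter fun m : ℕ => ‖phase α (2 * m) - 1‖ < c'
  set B : ℤ → Finset ℕ := fun l =>
    I.filter fun m : ℕ => ‖phase α (m + l) - 1‖ < c' / (1 + l.natAbs : ℝ) ^ (2 * t) with hB
  have hB0 : B0.card ≤ Y / 8 + 1 := by
    refine card_le_of_separated (Finset.filter_subset _ _) (fun m hm n hn hmn => ?_) (by norm_num)
    have h := le_sub_of_near (q := 16) (c' := c') hd (m := 2 * m) (n := 2 * n) (by omega)
      (by rw [hc']; field_simp; rfl) (Finset.mem_filter.1 hm).2 (Finset.mem_filter.1 hn).2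
    have : (16 : ℤ) ≤ 2 * n - 2 * m := by exact_mod_cast h
    omega
  have hBl : ∀ l : ℤ, ((B l).card : ℝ) ≤ Y / (16 * ((l.natAbs : ℝ) + 1) ^ 2) + 1 := fun l => by
    have h1 : (B l).card ≤ Y / (16 * (l.natAbs + 1) ^ 2) + 1 := by
      refine card_le_of_separated (Finset.filter_subset _ _) (fun m hm n hn hmn => ?_)
        (by positivity)
      have h := le_sub_of_near (q := (16 * (l.natAbs + 1) ^ 2   : ℕ)) hd (m := m + l) (n := n + l)
        (by omega) (le_of_eq ?_) (Finset.mem_filter.1 hm).2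
        (Finset.mem_filter.1 hn).2
      · have : ((16 * (l.natAbs + 1) ^ 2 : ℕ) : ℤ) ≤ n + l - (m + l) := by
          rw [← Int.cast_natCast (R := ℝ)] at h; exact Int.cast_le.1 h
        omega
      · rw [hc', pow_mul]
        push_cast
        rw [mul_pow, add_comm (1 : ℝ)]
        field_simp
    calc ((B l).card : ℝ) ≤ ((Y / (16 * (l.natAbs + 1) ^ 2) + 1 : ℕ) : ℝ) := by exact_mod_cast h1
      _ ≤ _ := by
        push_cast
        gcongr
        refine Nat.cast_div_le.trans (le_of_eq ?_)
        push_cast; rfl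
  set U := B0 ∪ (Finset.range (Y / 8 + 1)).biUnion fun k => B k ∪ B (-k)
  have hU : (U.card : ℝ) < I.card := by
    have h1 : (U.card : ℝ) ≤ B0.card + ∑ k ∈ Finset.range (Y / 8 + 1), (((B k).card : ℝ) +
        (B (-(k : ℤ))).card) := by
      refine le_trans (Nat.cast_le.2 ((Finset.card_union_le _ _).trans (Nat.add_le_add_left
        (Finset.card_biUnion_le.trans (Finset.sum_le_sum fun k _ =>
          Finset.card_union_le _ _)) _))) ?_
      push_cast
      rfl
    have h2 : ∑ k ∈ Finset.range (Y / 8 + 1), (((B k).card : ℝ) + (B (-(k : ℤ))).card) ≤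
        ∑ k ∈ Finset.range (Y / 8 + 1), ((Y / 8 : ℝ) * (1 / ((k : ℝ) + 1) ^ 2) + 2) := by
      refine Finset.sum_le_sum fun k _ => ?_
      have h3 := hBl k
      have h4 := hBl (-(k : ℤ))
      rw [Int.natAbs_neg, Int.natAbs_natCast] at h4
      rw [Int.natAbs_natCast] at h3
      refine (add_le_add h3 h4).trans (le_of_eq ?_)
      field_simp
      ring
    rw [Finset.sum_add_distrib (g := fun _ => (2 : ℝ)), ← Finset.mul_sum, Finset.sum_const,
      Finset.card_range, nsmul_eq_mul] at h2
    have h5 := sum_inv_sq_le (Y / 8)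
    have h6 : (0 : ℝ) ≤ 1 / ((Y / 8 : ℕ) + 1) := by positivity
    have h7 : (Y / 8 : ℝ) * ∑ k ∈ Finset.range (Y / 8 + 1), 1 / ((k : ℝ) + 1) ^ 2 ≤ Y / 8 * 2 := by
      gcongr; linarith
    have h8 : ((Y / 8 : ℕ) : ℝ) ≤ Y / 8 := by
      refine Nat.cast_div_le.trans (le_of_eq ?_); norm_num
    have h9 : (B0.card : ℝ) ≤ (Y / 8 : ℕ) + 1 := by exact_mod_cast hB0
    have h10 : I.card = Y := by rw [hI, Nat.card_Ico]; omega
    have h11 : (16 : ℝ) ≤ Y := by exact_mod_cast hY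
    rw [h10]
    push_cast at h2
    linarith
  obtain ⟨m, hmI, hmU⟩ := Finset.exists_mem_notMem_of_card_lt_card (by exact_mod_cast hU)
  have hmI' := Finset.mem_Ico.1 hmI
  refine ⟨m, hmI'.1, hmI'.2, ⟨?_, fun l hl => ?_⟩⟩
  · by_contra h
    exact hmU (Finset.mem_union_left _ (Finset.mem_filter.2 ⟨hmI, not_le.1 h⟩))
  · by_contra h
    refine hmU (Finset.mem_union_right _ (Finset.mem_biUnion.2
      ⟨l.natAbs, Finset.mem_range.2 (by omega), ?_⟩))
    have hl : m ∈ B l := by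
      refine Finset.mem_filter.2 ⟨hmI, ?_⟩
      rw [lt_div_iff₀ (by positivity), mul_comm]
      exact not_le.1 h
    rcases Int.natAbs_eq l with h' | h'
    · exact Finset.mem_union_left _ (h' ▸ hl)
    · exact Finset.mem_union_right _ (h' ▸ hl)

theorem IsGood.smallDivisors {α c c1 : ℝ} {t L m : ℕ} (hd : IsDioph α c1 t) (hc1 : c ≤ c1)
    (hc : 0 < c) (hm : IsGood α c (2 * t) (3 * L) m) {z : ℂ} (hz : z ^ 2 = phase α m) :
    SmallDivisors α z (1 / c) (2 * t) L := by
  intro D hD1 hDL l hl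
  have hD : (1 : ℝ) ≤ D := by exact_mod_cast hD1
  have hlD : (l.natAbs : ℝ) ≤ 3 * D := by exact_mod_cast hl
  have hl0 : (0 : ℝ) ≤ l.natAbs := Nat.cast_nonneg _
  rw [hz, ← phase_add]
  have key : ∀ a b : ℝ, 0 ≤ a → c ≤ b * a → b ≤ (4 * D : ℝ) ^ (2 * t) →
      1 ≤ 1 / c * (4 * D : ℝ) ^ (2 * t) * a := fun a b ha h1 h2 => by
    rw [one_div, mul_assoc, inv_mul_eq_div, one_le_div hc]
    exact h1.trans (mul_le_mul_of_nonneg_right h2 ha)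
  refine ⟨fun h0 => key _ _ (norm_nonneg _) (hc1.trans (hd l h0)) ?_,
    key _ _ (norm_nonneg _) (hm.near l (by omega)) ?_⟩
  · rw [← Int.cast_abs, ← Nat.cast_natAbs]
    calc ((l.natAbs : ℝ)) ^ t ≤ (4 * D : ℝ) ^ t := by gcongr; linarith
      _ ≤ _ := pow_le_pow_right₀ (by linarith) (by omega)
  · gcongr; linarith

end TrigPoly

section Growth

open Filter

theorem tendsto_natCast_rpow_atTop {s : ℝ} (hs : 0 < s) :
    Tendsto (fun m : ℕ => (m : ℝ) ^ s) atTop atTop :=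
  (tendsto_rpow_atTop hs).comp tendsto_natCast_atTop_atTop

theorem eventually_exp_neg_rpow_le {s a b : ℝ} (hs : 0 < s) (ha : 0 < a) (hb : 0 < b) :
    ∀ᶠ m : ℕ in atTop, Real.exp (-(b * (m : ℝ) ^ s)) ≤ a := by
  have h : Tendsto (fun m : ℕ => Real.exp (-(b * (m : ℝ) ^ s))) atTop (nhds 0) :=
    Real.tendsto_exp_neg_atTop_nhds_zero.comp
      ((tendsto_natCast_rpow_atTop hs).const_mul_atTop hb)
  exact h.eventually_le_const ha

theorem eventually_pow_mul_exp_le {s : ℝ} (hs : 0 < s) (C : ℝ) (T : ℕ) :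
    ∀ᶠ m : ℕ in atTop, C * (16 * m : ℝ) ^ T * (2 * Real.exp (-(m : ℝ) ^ s)) ≤
      Real.exp (-(1 / 2 * (m : ℝ) ^ s)) := by
  have h1 := (tendsto_rpow_mul_exp_neg_mul_atTop_nhds_zero (T / s) (1 / 2) (by norm_num)).comp
    (tendsto_natCast_rpow_atTop hs)
  have h2 : Tendsto (fun m : ℕ => C * 16 ^ T * 2 * (((m : ℝ) ^ s) ^ (T / s) *
      Real.exp (-(1 / 2) * (m : ℝ) ^ s))) atTop (nhds 0) := by
    simpa using h1.const_mul (C * 16 ^ T * 2)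
  filter_upwards [h2.eventually_le_const zero_lt_one] with m hm
  have h3 : ((m : ℝ) ^ s) ^ (T / s) = (m : ℝ) ^ T := by
    rw [← Real.rpow_mul (Nat.cast_nonneg _), mul_div_cancel₀ _ hs.ne', Real.rpow_natCast]
  have h4 : Real.exp (-(m : ℝ) ^ s) =
      Real.exp (-(1 / 2) * (m : ℝ) ^ s) * Real.exp (-(1 / 2 * (m : ℝ) ^ s)) := by
    rw [← Real.exp_add]; congr 1; ring
  rw [h3] at hm
  rw [h4, mul_pow]
  calc _ = C * 16 ^ T * 2 * ((m : ℝ) ^ T * Real.exp (-(1 / 2) * (m : ℝ) ^ s)) *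
        Real.exp (-(1 / 2 * (m : ℝ) ^ s)) := by ring
    _ ≤ 1 * Real.exp (-(1 / 2 * (m : ℝ) ^ s)) := by gcongr
    _ = _ := one_mul _

theorem eventually_rpow_add_le {s a : ℝ} (hs0 : 0 < s) (hs : s < 1 / 2) (ha : 0 < a) {C : ℝ}
    (hC : 0 ≤ C) : ∀ᶠ y : ℕ in atTop, (2 * y : ℝ) ^ s + C ≤ a * √y := by
  filter_upwards [(tendsto_natCast_rpow_atTop (sub_pos.2 hs)).eventually_ge_atTop ((2 + C) / a),
    eventually_ge_atTop 1] with y hy hy1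
  have hy1' : (1 : ℝ) ≤ y := by exact_mod_cast hy1
  have hys : 1 ≤ (y : ℝ) ^ s := Real.one_le_rpow hy1' hs0.le
  rw [div_le_iff₀ ha] at hy
  have h2 : (2 : ℝ) ^ s ≤ 2 := by
    conv_rhs => rw [← Real.rpow_one 2]
    exact Real.rpow_le_rpow_of_exponent_le (by norm_num) (by linarith)
  have h3 : √(y : ℝ) = (y : ℝ) ^ (1 / 2 - s) * (y : ℝ) ^ s := by
    rw [Real.sqrt_eq_rpow, ← Real.rpow_add (by linarith), sub_add_cancel]
  rw [Real.mul_rpow (by norm_num) (by linarith), h3]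
  nlinarith

theorem eventually_exists_steps {s η : ℝ} (hs0 : 0 < s) (hs : s < 1 / 2) (hη : 0 < η) (hη1 : η ≤ 1)
    {k : ℕ} (hk : 1 ≤ k) :
    ∀ᶠ Y : ℕ in atTop, ∀ m : ℕ, m < 2 * Y → ∃ n, 4 ^ n * k ≤ Y / 24 ∧
      Real.exp (-(1 / 2 * (k : ℝ) ^ s)) ^ (2 ^ n) ≤ η * Real.exp (-(m : ℝ) ^ s) := by
  have hk' : (1 : ℝ) ≤ k := by exact_mod_cast hk
  filter_upwards [eventually_rpow_add_le hs0 hs (a := 1 / 2 / √(96 * k)) (by positivity)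
    (neg_nonneg.2 (Real.log_nonpos hη.le hη1)), eventually_ge_atTop (24 * k)] with Y hY hYk m hm
  have hx : Y / (24 * k) ≠ 0 := (Nat.div_pos hYk (by omega)).ne'
  refine ⟨Nat.log 4 (Y / (24 * k)), ?_, ?_⟩
  · have := Nat.pow_log_le_self 4 hx
    rw [Nat.le_div_iff_mul_le (by omega)] at this
    rw [Nat.le_div_iff_mul_le (by omega)]
    linarith
  · have h1 := Nat.lt_pow_succ_log_self (b := 4) (by norm_num) (Y / (24 * k))
    set n := Nat.log 4 (Y / (24 * k))
    rw [Nat.div_lt_iff_lt_mul (by omega)] at h1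
    have h2 : (Y : ℝ) ≤ (2 ^ n) ^ 2 * (96 * k) := by
      have : (Y : ℝ) ≤ 4 ^ (n + 1) * (24 * k) := by exact_mod_cast h1.le
      rw [← pow_mul, mul_comm n 2, pow_mul]
      rw [pow_succ] at this
      norm_num
      linarith
    have h3 : √(Y : ℝ) / √(96 * k) ≤ 2 ^ n := by
      rw [div_le_iff₀ (by positivity)]
      refine (Real.sqrt_le_sqrt h2).trans (le_of_eq ?_)
      rw [Real.sqrt_mul (by positivity), Real.sqrt_sq (by positivity)]
    have h4 : (m : ℝ) ^ s ≤ (2 * Y : ℝ) ^ s := by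
      refine Real.rpow_le_rpow (by positivity) ?_ hs0.le
      exact_mod_cast hm.le
    have h5 : (1 : ℝ) ≤ (k : ℝ) ^ s := Real.one_le_rpow hk' hs0.le
    rw [← Real.exp_nat_mul, ← Real.exp_log hη, ← Real.exp_add, Real.exp_le_exp]
    push_cast
    have h6 : 1 / 2 / √(96 * k : ℝ) * √Y = 1 / 2 * (√(Y : ℝ) / √(96 * k)) := by ring
    have h7 : (2 : ℝ) ^ n * 1 ≤ 2 ^ n * (k : ℝ) ^ s := by gcongr
    rw [h6] at hY
    linarith

namespace TrigPoly

theorem IsGood.mono {α c : ℝ} {T M M' m : ℕ} (h : IsGood α c T M m) (hM : M' ≤ M) :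
    IsGood α c T M' m := ⟨h.double, fun l hl => h.near l (hl.trans hM)⟩

theorem exists_scales {α c s : ℝ} {t : ℕ} (hs0 : 0 < s) (hs : s < 1 / 2) (hc : 0 < c)
    (hex : ∀ Y : ℕ, 16 ≤ Y → ∃ m, Y ≤ m ∧ m < 2 * Y ∧ IsGood α c (2 * t) (Y / 8) m) :
    ∃ m L : ℕ → ℕ, Scales (1 / c) c (c / 4000) (1 / 1000) (2 * t) m L
      (fun i => Real.exp (-(m i : ℝ) ^ s)) (fun i => Real.exp (-(1 / 2 * (m i : ℝ) ^ s))) ∧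
      ∀ i, 20 ≤ (m i : ℝ) ^ s ∧
        Real.exp (-(m (i + 1) : ℝ) ^ s) ≤ Real.exp (-(m i : ℝ) ^ s) / 2001 ∧
        IsGood α c (2 * t) (3 * L i) (m i) := by
  have hbase : ∀ᶠ m : ℕ in atTop, 1 ≤ m ∧ 20 ≤ (m : ℝ) ^ s ∧
      240 * (1 / c) / c * (16 * m : ℝ) ^ (2 * t) * (2 * Real.exp (-(m : ℝ) ^ s)) ≤
      Real.exp (-(1 / 2 * (m : ℝ) ^ s)) ∧ Real.exp (-(1 / 2 * (m : ℝ) ^ s)) ≤ c / 4000 / 4 := by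
    filter_upwards [eventually_ge_atTop 1,
      (tendsto_natCast_rpow_atTop hs0).eventually_ge_atTop 20,
      eventually_pow_mul_exp_le hs0 (240 * (1 / c) / c) (2 * t),
      eventually_exp_neg_rpow_le hs0
        (a := c / 4000 / 4) (b := 1 / 2) (by positivity)
        (by norm_num)] with m h1 h2 h3 h4 using ⟨h1, h2, h3, h4⟩
  obtain ⟨N, hN⟩ := eventually_atTop.1 hbase
  let P : Type := {p : ℕ × ℕ // p.1 ≤ p.2 ∧ N ≤ p.1 ∧ IsGood α c (2 * t) (p.1 / 8) p.2}
  have hmk : ∀ Y : ℕ, max 16 N ≤ Y → ∃ p : P, p.1.1 = Y ∧ p.1.2 < 2 * Y := fun Y hY => by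
    obtain ⟨m, h1, h2, h3⟩ := hex Y (le_trans (le_max_left _ _) hY)
    exact ⟨⟨(Y, m), h1, (le_max_right _ _).trans hY, h3⟩, rfl, h2⟩
  have hnext : ∀ p : P, ∃ q : P, p.1.1 ≤ q.1.1 ∧
      Real.exp (-(1 / 2 * (q.1.2 : ℝ) ^ s)) ≤ Real.exp (-(1 / 2 * (p.1.2 : ℝ) ^ s)) / 2 ∧
      Real.exp (-(q.1.2 : ℝ) ^ s) ≤ Real.exp (-(p.1.2 : ℝ) ^ s) / 2001 ∧
      ∃ n, 4 ^ n * p.1.2 ≤ q.1.1 / 24 ∧ Real.exp (-(1 / 2 * (p.1.2 : ℝ) ^ s)) ^ (2 ^ n) ≤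
        1 / 1000 * Real.exp (-(q.1.2 : ℝ) ^ s) := fun p => by
    have hp := hN p.1.2 (p.2.2.1.trans p.2.1)
    obtain ⟨Y, h1, h2, h3, h4, h5⟩ := ((eventually_ge_atTop (max 16 N)).and
      ((eventually_ge_atTop p.1.1).and
      ((eventually_forall_ge_atTop.2 (eventually_exp_neg_rpow_le hs0
        (a := Real.exp (-(1 / 2 * (p.1.2 : ℝ) ^ s)) / 2) (b := 1 / 2)
        (by positivity) (by norm_num))).and
      ((eventually_forall_ge_atTop.2 (eventually_exp_neg_rpow_le hs0
        (a := Real.exp (-(p.1.2 : ℝ) ^ s) / 2001) (b := 1)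
        (by positivity) (by norm_num))).and
      (eventually_exists_steps hs0 hs (η := 1 / 1000) (by norm_num) (by norm_num) hp.1))))).exists
    obtain ⟨q, hqY, hq2⟩ := hmk Y h1
    have hqm : Y ≤ q.1.2 := hqY ▸ q.2.1
    refine ⟨q, hqY ▸ h2, h3 _ hqm, by simpa using h4 _ hqm, ?_⟩
    rw [hqY]
    exact h5 _ hq2
  choose F hF using hnext
  obtain ⟨p0, -, -⟩ := hmk _ le_rfl
  let p : ℕ → P := fun n => Nat.rec p0 (fun _ q => F q) n
  have hpN : ∀ i, _ := fun i => hN (p i).1.2 ((p i).2.2.1.trans (p i).2.1)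
  refine ⟨fun i => (p i).1.2, fun i => (p i).1.1 / 24, ⟨fun i => (hpN i).1, fun i => Real.exp_pos _,
    fun i => (hpN i).2.2.1, fun i => ?_, ?_, fun i => ?_, ?_, fun i => ?_⟩,
    fun i => ⟨(hpN i).2.1, ?_, (p i).2.2.2.mono ?_⟩⟩
  · exact (hF (p i)).2.1
  · have := (hpN 0).2.2.2; linarith
  · exact (hF (p i)).2.2.2
  · refine monotone_nat_of_le_succ fun i => Nat.div_le_div_right (hF (p i)).1
  · exact (Nat.div_le_self _ _).trans (p i).2.1
  · exact (hF (p i)).2.2.1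
  · dsimp only; omega

end TrigPoly

end Growth

theorem norm_single_natCast {d : ℕ} (i : Fin d) (m : ℤ) :
    ‖(Pi.single i m : Fin d → ℤ)‖ = |(m : ℝ)| := by
  rw [Pi.norm_single, Int.norm_eq_abs]

theorem sum_single_mul {d : ℕ} (i₀ : Fin d) (m : ℤ) (x : Fin d → ℝ) :
    ∑ i, ((Pi.single i₀ m : Fin d → ℤ) i : ℝ) * x i = m * x i₀ := by
  rw [Finset.sum_eq_single i₀ (fun i _ hi => by simp [hi]) (by simp)]
  simp

theorem IsDiophantine.isDioph {d : ℕ} {γ τ : ℝ} {α : Fin d → ℝ}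
    (hα : IsDiophantine d γ τ α) (i₀ : Fin d) {t : ℕ} (ht : τ ≤ t) :
    TrigPoly.IsDioph (α i₀) (min (γ / 2) 1) t := by
  intro m hm
  have hm1 : (1 : ℝ) ≤ |(m : ℝ)| := by exact_mod_cast Int.one_le_abs hm
  obtain ⟨j, hj⟩ := half_abs_le_norm_exp_sub_one (α i₀ * m)
  have h := hα (Pi.single i₀ m) (by simpa using hm) j
  rw [sum_single_mul, norm_single_natCast, gt_iff_lt, div_lt_iff₀ (by positivity),
    mul_comm (m : ℝ)] at h
  have hpow : |(m : ℝ)| ^ τ ≤ |(m : ℝ)| ^ t := by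
    rw [← Real.rpow_natCast]; exact Real.rpow_le_rpow_of_exponent_le hm1 ht
  have hphase : |α i₀ * m - 2 * π * j| ≤ 2 * ‖TrigPoly.phase (α i₀) m - 1‖ := by
    rw [TrigPoly.phase]; push_cast at hj ⊢; linarith
  have h2 := mul_le_mul hphase hpow (by positivity) (by positivity)
  refine (min_le_left _ _).trans ?_
  nlinarith

theorem le_geometric_of_succ_le {ε : ℕ → ℝ} (h : ∀ i, ε (i + 1) ≤ ε i / 2001) (i j : ℕ) :
    ε (i + j) ≤ ε j * (1 / 2001) ^ i := by
  induction i with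
  | zero => simp
  | succ i ih =>
    rw [add_right_comm, pow_succ]
    linarith [h (i + j)]

theorem summable_of_succ_le {ε : ℕ → ℝ} (h0 : ∀ i, 0 < ε i)
    (h : ∀ i, ε (i + 1) ≤ ε i / 2001) : Summable ε :=
  Summable.of_nonneg_of_le (fun i => (h0 i).le) (fun i => le_geometric_of_succ_le h i 0)
    ((summable_geometric_of_lt_one (by norm_num) (by norm_num)).mul_left _)

theorem tsum_tail_le_of_succ_le {ε : ℕ → ℝ} (h0 : ∀ i, 0 < ε i)
    (h : ∀ i, ε (i + 1) ≤ ε i / 2001) (j : ℕ) : ∑' i, ε (i + (j + 1)) ≤ ε j / 1000 := by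
  have hg : HasSum (fun i => ε (j + 1) * (1 / 2001 : ℝ) ^ i) (ε (j + 1) * (1 - 1 / 2001)⁻¹) :=
    (hasSum_geometric_of_lt_one (by norm_num) (by norm_num)).mul_left _
  have := ((summable_nat_add_iff (j + 1)).2 (summable_of_succ_le h0 h)).tsum_le_tsum
    (fun i => le_geometric_of_succ_le h i (j + 1)) hg.summable
  rw [hg.tsum_eq] at this
  norm_num at this
  linarith [h j, h0 j]

theorem gap_lower_bound {l y : ℝ} (hl0 : 0 ≤ l) (hl : l ≤ 1) (hy : 20 ≤ y) :
    l ^ 2 * Real.exp (-(13 / 6) * y ^ 2) ≤ l * Real.exp (-y) / 10 := by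
  have h1 : Real.exp (-(13 / 6) * y ^ 2) ≤ Real.exp (-y) / 10 := by
    have h2 : Real.exp (-(13 / 6) * y ^ 2) ≤ Real.exp (-y) * Real.exp (-y) := by
      rw [← Real.exp_add]; apply Real.exp_le_exp.2; nlinarith
    have h3 : Real.exp (-y) ≤ 1 / 10 := by
      rw [Real.exp_neg, inv_eq_one_div]
      exact one_div_le_one_div_of_le (by norm_num) (by linarith [Real.add_one_le_exp y])
    nlinarith [Real.exp_pos (-y)]
  have h4 : l ^ 2 ≤ l := by nlinarith
  calc _ ≤ l * (Real.exp (-y) / 10) := by gcongr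
    _ = _ := by ring

theorem gap_upper_bound {l y : ℝ} (hl0 : 0 ≤ l) (hl : l ≤ 1) (hy : 20 ≤ y) :
    12 * (l * Real.exp (-y)) ≤ √l * Real.exp (-(3 / 20) * y) := by
  have h1 : l ≤ √l := Real.le_sqrt_of_sq_le (by nlinarith)
  have h2 : 12 * Real.exp (-y) ≤ Real.exp (-(3 / 20) * y) := by
    have : Real.exp (-(3 / 20) * y) = Real.exp (17 / 20 * y) * Real.exp (-y) := by
      rw [← Real.exp_add]; ring_nf
    rw [this]
    gcongr
    linarith [Real.add_one_le_exp (17 / 20 * y)]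
  calc _ = l * (12 * Real.exp (-y)) := by ring
    _ ≤ _ := by gcongr

end Auxiliary

/-- For a Diophantine frequency `α` there is an infinite set `K ⊆ ℤ^d`
such that, with the Gevrey potential `v(θ) = Σ_{k∈K} e^{−|k|^s} cos⟨k,θ⟩`, for every
`0 < |λ| ≤ 1` and every phase `θ`, to each `k ∈ K` one can assign a spectral gap
`I_k = (E_k⁻, E_k⁺)` (an open interval contained in the complement of the spectrum whose
endpoints lie in the spectrum, i.e. a bounded connected component of the complement)
whose length satisfies
`|λ|² e^{−(13/6)|k|^{2s}} ≤ E_k⁺ − E_k⁻ ≤ |λ|^{1/2} e^{−(3/20)|k|^s}`,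
the assignment `k ↦ (E_k⁻, E_k⁺)` being injective on `K`. -/
theorem open_spectral_gaps_gevrey
    (d : ℕ) (hd : 1 ≤ d) (s γ τ : ℝ) (hs0 : 0 < s) (hs : s < 1/2)
    (hγ : 0 < γ) (hτ : (d : ℝ) - 1 < τ)
    (α : Fin d → ℝ) (hα : IsDiophantine d γ τ α) :
    ∃ K : Set (Fin d → ℤ),
      K.Infinite ∧
      Summable (fun k : K => Real.exp (-‖(k : Fin d → ℤ)‖ ^ s)) ∧
      ∀ lam : ℝ, 0 < |lam| → |lam| ≤ 1 → ∀ θ : Fin d → ℝ,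
        ∀ H : lp (fun _ : ℤ => ℝ) 2 →L[ℝ] lp (fun _ : ℤ => ℝ) 2,
          (∀ u : lp (fun _ : ℤ => ℝ) 2, ∀ n : ℤ,
            H u n = u (n + 1) + u (n - 1) +
              lam * (∑' k : K, Real.exp (-‖(k : Fin d → ℤ)‖ ^ s) *
                Real.cos (∑ i, ((k : Fin d → ℤ) i : ℝ) * (θ i + (n : ℝ) * α i))) * u n) →
          ∃ Em Ep : (Fin d → ℤ) → ℝ,
            (∀ k ∈ K,
              Em k ∈ spectrum ℝ H ∧ Ep k ∈ spectrum ℝ H ∧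
              Set.Ioo (Em k) (Ep k) ⊆ (spectrum ℝ H)ᶜ ∧
              |lam| ^ 2 * Real.exp (-(13/6) * ‖k‖ ^ (2 * s)) ≤ Ep k - Em k ∧
              Ep k - Em k ≤ Real.sqrt |lam| * Real.exp (-(3/20) * ‖k‖ ^ s)) ∧
            Set.InjOn (fun k => (Em k, Ep k)) K := by
  let i₀ : Fin d := ⟨0, hd⟩
  obtain ⟨t, ht⟩ := exists_nat_ge τ
  have hdio := hα.isDioph i₀ ht
  set c₁ := min (γ / 2) 1
  have hc₁ : 0 < c₁ := lt_min (by positivity) one_pos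
  set c := c₁ / (2 * 16 ^ t) with hc_def
  have hc : 0 < c := by positivity
  have hcc₁ : c ≤ c₁ := div_le_self hc₁.le (by
    linarith [one_le_pow₀ (n := t) (by norm_num : (1 : ℝ) ≤ 16)])
  have hc1 : c ≤ 1 := hcc₁.trans (min_le_right _ _)
  obtain ⟨m, L, hS, hm⟩ := TrigPoly.exists_scales hs0 hs hc
    (fun Y hY => TrigPoly.exists_isGood hc₁ hdio hY)
  set ε : ℕ → ℝ := fun i => Real.exp (-(m i : ℝ) ^ s) with hε_def
  have hε0 : ∀ i, 0 < ε i := fun i => Real.exp_pos _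
  have hε1 : ∀ i, ε (i + 1) ≤ ε i / 2001 := fun i => (hm i).2.1
  have hεlt : ∀ {i j}, i < j → ε j ≤ ε i / 2001 := fun {i j} hij =>
    (antitone_nat_of_succ_le (fun n => by linarith [hε1 n, hε0 n]) hij).trans (hε1 i)
  have hm_inj : Function.Injective m := fun i j hij => by
    have h : ε i = ε j := by simp only [hε_def, hij]
    rcases lt_trichotomy i j with h1 | h1 | h1
    · linarith [hεlt h1, hε0 i]
    · exact h1
    · linarith [hεlt h1, hε0 j]
  have hsum := summable_of_succ_le hε0 hε1
  let f : ℕ → Fin d → ℤ := fun j => Pi.single i₀ (m j : ℤ)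
  have hf : Function.Injective f := fun i j hij =>
    hm_inj (by exact_mod_cast Pi.single_injective i₀ hij)
  have hnorm : ∀ j, ‖f j‖ = m j := fun j => by
    simp only [f, norm_single_natCast]; simp
  refine ⟨Set.range f, Set.infinite_range_of_injective hf, ?_, ?_⟩
  · rw [← (Equiv.ofInjective f hf).summable_iff]
    simpa [Function.comp_def, hnorm] using hsum
  intro lam hlam0 hlam θ H hH
  have hgap := fun j => TrigPoly.exists_gap_of_scales hS hc
    (by rw [le_div_iff₀ hc]; linarith) le_rfl (by norm_num) le_rfl hlam0 hlam hsum j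
    (tsum_tail_le_of_succ_le hε0 hε1 j) (by simpa using (hm j).2.2.near 0 (by simp))
    (hm j).2.2.double (fun z hz => (hm j).2.2.smallDivisors hdio hcc₁ hc hz) H
    (x0 := θ i₀) (fun u n => by
      rw [hH u n, tsum_range (fun k => Real.exp (-‖k‖ ^ s) *
        Real.cos (∑ i, (k i : ℝ) * (θ i + (n : ℝ) * α i))) hf]
      simp only [hnorm, f, sum_single_mul, Int.cast_natCast, hε_def])
  choose Em hEm Ep hEp hIoo hlo hup using hgap
  have hinv : ∀ j, Function.invFun f (f j) = j := Function.leftInverse_invFun hf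
  refine ⟨fun k => Em (Function.invFun f k), fun k => Ep (Function.invFun f k), ?_, ?_⟩
  · rintro _ ⟨j, rfl⟩
    simp only [hinv, hnorm]
    refine ⟨hEm j, hEp j, hIoo j, ?_, ?_⟩
    · refine le_trans ?_ (hlo j)
      rw [mul_comm 2 s, Real.rpow_mul (Nat.cast_nonneg _), Real.rpow_two]
      exact gap_lower_bound hlam0.le hlam (hm j).1
    · exact (hup j).trans (gap_upper_bound hlam0.le hlam (hm j).1)
  · have key : ∀ {i j}, i < j → Em i = Em j → Ep i ≠ Ep j := fun {i j} hij h1 h2 => by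
      have h3 := hlo i
      have h4 := hup j
      rw [h1, h2] at h3
      nlinarith [hεlt hij, hε0 i, mul_le_mul_of_nonneg_left (hεlt hij) hlam0.le,
        mul_pos hlam0 (hε0 i)]
    rintro _ ⟨i, rfl⟩ _ ⟨j, rfl⟩ h
    simp only [hinv, Prod.mk.injEq] at h
    rcases lt_trichotomy i j with h1 | rfl | h1
    · exact absurd h.2 (key h1 h.1)
    · rfl
    · exact absurd h.2.symm (key h1 h.1.symm)
end

section
/- Let α ∈ ℝ, let M > 1 be a real number, and let Q be a positive integer with Q < M and ‖Qα‖_{ℝ/ℤ} ≤ 1/M, where ‖x‖_{ℝ/ℤ} = inf_{p∈ℤ} |x − p|. Then there exists a positive integer q with 21M/20 ≤ q ≤ 41M/20 such that ‖qα‖_{ℝ/ℤ} < 3/Q. -/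
/-- The distance from a real number to the nearest integer, `‖x‖_{ℝ/ℤ} = inf_{p∈ℤ} |x − p|`. -/
noncomputable def distToInt (x : ℝ) : ℝ := ⨅ p : ℤ, |x - (p : ℝ)|

theorem distToInt_le (x : ℝ) (p : ℤ) : distToInt x ≤ |x - p| :=
  ciInf_le ⟨0, by rintro _ ⟨n, rfl⟩; exact abs_nonneg _⟩ p

theorem abs_sub_round_le_distToInt (x : ℝ) : |x - round x| ≤ distToInt x :=
  le_ciInf fun p => round_le x p

theorem distToInt_nat_mul_le (k : ℕ) (x : ℝ) : distToInt (k * x) ≤ k * distToInt x := by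
  calc distToInt (k * x) ≤ |k * x - ((k * round x : ℤ) : ℝ)| := distToInt_le _ _
    _ = k * |x - round x| := by
      push_cast
      rw [← mul_sub, abs_mul, Nat.abs_cast]
    _ ≤ k * distToInt x := by
      gcongr
      exact abs_sub_round_le_distToInt x

/-- If `M > 1`, `Q` is a positive integer with `Q < M` and
`‖Qα‖_{ℝ/ℤ} ≤ 1/M`, then there is a positive integer `q` with
`21M/20 ≤ q ≤ 41M/20` and `‖qα‖_{ℝ/ℤ} < 3/Q`. -/
theorem exists_good_denominator
    (α M : ℝ) (hM : 1 < M) (Q : ℕ) (hQ : 0 < Q) (hQM : (Q : ℝ) < M)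
    (hQα : distToInt ((Q : ℝ) * α) ≤ 1 / M) :
    ∃ q : ℕ, 0 < q ∧ 21 * M / 20 ≤ (q : ℝ) ∧ (q : ℝ) ≤ 41 * M / 20 ∧
      distToInt ((q : ℝ) * α) < 3 / (Q : ℝ) := by
  have hM0 : 0 < M := by linarith
  have hQ0 : (0 : ℝ) < Q := by exact_mod_cast hQ
  have hx : 0 < 21 * M / 20 / Q := by positivity
  set k := ⌈21 * M / 20 / Q⌉₊ with hk
  have hlow : 21 * M / 20 ≤ k * Q := (div_le_iff₀ hQ0).1 (Nat.le_ceil _)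
  have hup : (k : ℝ) * Q ≤ 41 * M / 20 := by
    have h := mul_lt_mul_of_pos_right (Nat.ceil_lt_add_one hx.le) hQ0
    rw [add_mul, div_mul_cancel₀ _ hQ0.ne', ← hk] at h
    linarith
  refine ⟨k * Q, Nat.mul_pos (Nat.ceil_pos.2 hx) hQ, by exact_mod_cast hlow,
    by exact_mod_cast hup, ?_⟩
  push_cast
  rw [mul_assoc]
  calc distToInt (k * (Q * α)) ≤ k * distToInt (Q * α) := distToInt_nat_mul_le k _
    _ ≤ k * (1 / M) := by gcongr
    _ < 3 / Q := by
      rw [mul_one_div, div_lt_div_iff₀ hM0 hQ0]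
      linarith
end

section
/- Let d ≥ 1 and let α ∈ ℝ^d be such that ⟨k,α⟩ ∉ 2πℤ for every k ∈ ℤ^d ∖ {0} (i.e. (2π, α₁, …, α_d) are rationally independent). Let s ∈ (0,1/2), let N ≥ 2 be an integer, and set N_j = N^{12/s + j − 1} for j = 1, 2, …. Then there exists a set K ⊆ ℤ^d such that: (i) every k ∈ K satisfies |k| ≥ N₁; (ii) for every j ≥ 1, the set {k ∈ K : N_j ≤ |k| < N_{j+2}} has at most one element; and (iii) the image of {⟨k,α⟩/2 : k ∈ K} in ℝ/2πℤ is dense. -/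
open scoped Real BigOperators

/-- If every point is a cluster point of `x`, then `x` has a subsequence with dense range whose
indices grow at least as fast as prescribed by `g`. -/
theorem exists_growing_subseq_denseRange {X : Type*} [TopologicalSpace X]
    [SecondCountableTopology X] [Nonempty X] {x : ℕ → X}
    (hx : ∀ y, MapClusterPt y Filter.atTop x) (M : ℕ) (g : ℕ → ℕ) :
    ∃ n : ℕ → ℕ, M ≤ n 0 ∧ (∀ i, g (n i) ≤ n (i + 1)) ∧ DenseRange (x ∘ n) := by
  obtain ⟨b, hbc, hbe, hb⟩ := TopologicalSpace.exists_countable_basis X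
  have hbn : b.Nonempty :=
    let ⟨t, ht, _⟩ := hb.exists_subset_of_mem_open (Set.mem_univ (Classical.arbitrary X)) isOpen_univ
    ⟨t, ht⟩
  obtain ⟨f, rfl⟩ := hbc.exists_eq_range hbn
  have visit (i m : ℕ) : ∃ n ≥ m, x n ∈ f i := by
    obtain ⟨y, hy⟩ : (f i).Nonempty :=
      Set.nonempty_iff_ne_empty.2 fun h => hbe ⟨i, h⟩
    exact Filter.frequently_atTop.1
      ((hx y).frequently ((hb.isOpen ⟨i, rfl⟩).mem_nhds hy)) m
  choose F hF hFf using visit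
  let n : ℕ → ℕ := Nat.rec (F 0 M) fun i m => F (i + 1) (g m)
  have hn (i : ℕ) : x (n i) ∈ f i := by
    cases i <;> exact hFf _ _
  refine ⟨n, hF _ _, fun i => hF _ _, hb.dense_iff.2 ?_⟩
  rintro _ ⟨i, rfl⟩ -
  exact ⟨x (n i), hn i, i, rfl⟩

/-- If no nonzero multiple of `a` vanishes on a circle of positive length, then every point of the
circle is a cluster point of the sequence of natural multiples of `a`. -/
theorem AddCircle.mapClusterPt_atTop_nsmul {p : ℝ} [Fact (0 < p)] {a : AddCircle p}
    (ha : addOrderOf a = 0) (y : AddCircle p) :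
    MapClusterPt y Filter.atTop (fun n : ℕ => n • a) := by
  rw [mapClusterPt_atTop_nsmul_iff_mem_topologicalClosure_zmultiples,
    ← SetLike.mem_coe, AddSubgroup.topologicalClosure_coe]
  exact AddCircle.denseRange_zsmul_iff.2 ha y

/-- Let `α ∈ ℝ^d` be rationally independent in the sense that
`⟨k,α⟩ ∉ 2πℤ` for all `k ∈ ℤ^d ∖ {0}`. Let `s ∈ (0,1/2)`, `N ≥ 2` and
`N_j = N^{12/s + j − 1}`. Then there is a set `K ⊆ ℤ^d` such that:
(i) every `k ∈ K` satisfies `|k| ≥ N₁`;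
(ii) for every `j ≥ 1` the set `{k ∈ K : N_j ≤ |k| < N_{j+2}}` has at most one element;
(iii) the image of `{⟨k,α⟩/2 : k ∈ K}` in `ℝ/2πℤ` is dense. -/
theorem exists_label_set
    (d : ℕ) (hd : 1 ≤ d) (α : Fin d → ℝ)
    (hα : ∀ k : Fin d → ℤ, k ≠ 0 → ∀ m : ℤ, (∑ i, (k i : ℝ) * α i) ≠ 2 * Real.pi * (m : ℝ))
    (s : ℝ) (hs0 : 0 < s) (hs : s < 1/2) (N : ℕ) (hN : 2 ≤ N) :
    ∃ K : Set (Fin d → ℤ),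
      (∀ k ∈ K, (N : ℝ) ^ (12/s + (1 : ℝ) - 1) ≤ ‖k‖) ∧
      (∀ j : ℕ, 1 ≤ j →
        Set.Subsingleton {k : Fin d → ℤ | k ∈ K ∧
          (N : ℝ) ^ (12/s + (j : ℝ) - 1) ≤ ‖k‖ ∧ ‖k‖ < (N : ℝ) ^ (12/s + ((j : ℝ) + 2) - 1)}) ∧
      Dense ((fun k : Fin d → ℤ =>
        (((∑ i, (k i : ℝ) * α i) / 2 : ℝ) : AddCircle (2 * Real.pi))) '' K) := by
  have : Fact (0 < 2 * Real.pi) := ⟨Real.two_pi_pos⟩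
  let i₀ : Fin d := ⟨0, hd⟩
  let e (n : ℕ) : Fin d → ℤ := Pi.single i₀ (n : ℤ)
  have e_sum (n : ℕ) : ∑ i, (e n i : ℝ) * α i = n * α i₀ := by
    rw [Finset.sum_eq_single i₀] <;> simp +contextual [e]
  have e_norm (n : ℕ) : ‖e n‖ = n := by simp [e, Pi.norm_single]
  have horder : addOrderOf ((α i₀ / 2 : ℝ) : AddCircle (2 * Real.pi)) = 0 := by
    refine addOrderOf_eq_zero_iff'.2 fun n hn h => ?_
    rw [← AddCircle.coe_nsmul, AddCircle.coe_eq_zero_iff] at h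
    obtain ⟨m, hm⟩ := h
    refine hα (e n) (fun h0 => hn.ne' ?_) (2 * m) ?_
    · simpa [e] using h0
    · rw [e_sum]
      simp only [zsmul_eq_mul, nsmul_eq_mul] at hm
      push_cast
      linarith
  obtain ⟨M, hM⟩ := exists_nat_ge ((N : ℝ) ^ (12 / s + (1 : ℝ) - 1))
  obtain ⟨n, hMn, hgrow, hdense⟩ := exists_growing_subseq_denseRange
    (AddCircle.mapClusterPt_atTop_nsmul horder) M (fun m => N ^ 2 * m)
  have hmono : Monotone n := monotone_nat_of_le_succ fun i =>
    (Nat.le_mul_of_pos_left _ (by positivity)).trans (hgrow i)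
  have hsep {i l : ℕ} (h : i < l) : (N : ℝ) ^ 2 * n i ≤ n l :=
    mod_cast (hgrow i).trans (hmono h)
  have hscale (j : ℕ) : (N : ℝ) ^ (12 / s + ((j : ℝ) + 2) - 1)
      = (N : ℝ) ^ 2 * (N : ℝ) ^ (12 / s + (j : ℝ) - 1) := by
    rw [← Real.rpow_natCast, ← Real.rpow_add (by positivity)]
    congr 1
    push_cast
    ring
  refine ⟨Set.range (e ∘ n), ?_, ?_, ?_⟩
  · rintro _ ⟨i, rfl⟩
    rw [Function.comp_apply, e_norm]
    exact hM.trans (mod_cast hMn.trans (hmono i.zero_le))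
  · rintro j - _ ⟨⟨i, rfl⟩, hi, hi'⟩ _ ⟨⟨l, rfl⟩, hl, hl'⟩
    simp only [Function.comp_apply, e_norm, hscale] at hi hi' hl hl' ⊢
    have contra {i l : ℕ} (hi : (N : ℝ) ^ (12 / s + (j : ℝ) - 1) ≤ n i)
        (hl : (n l : ℝ) < (N : ℝ) ^ 2 * (N : ℝ) ^ (12 / s + (j : ℝ) - 1)) : ¬ i < l := fun h =>
      (hl.trans_le ((mul_le_mul_of_nonneg_left hi (by positivity)).trans (hsep h))).false
    rw [le_antisymm (not_lt.1 (contra hl hi')) (not_lt.1 (contra hi hl'))]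
  · rw [← Set.range_comp]
    refine (congrArg (fun f => Dense (Set.range f)) (funext fun i => ?_)).mpr hdense
    simp only [Function.comp_apply, e_sum, ← AddCircle.coe_nsmul, nsmul_eq_mul, mul_div_assoc]
end
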